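/- arXiv:2409.00893 — 5 statements merged into one kernel-verified Lean document; each statement's English description precedes it below -/
import Mathlib

section
/- Let H be a real Hilbert space, let 0 < α < 1 and T > 0, and let φ, ψ : [0,T] → H be continuous functions. Then for every ε > 0 and every t ∈ [0,T], ∫_0^t ⟨(I^{1-α}φ)(s), ψ(s)⟩ ds ≤ ε ∫_0^t ⟨(I^{1-α}φ)(s), φ(s)⟩ ds + (1/(4 ε α²)) ∫_0^t ⟨(I^{1-α}ψ)(s), ψ(s)⟩ ds, where ⟨·,·⟩ denotes the inner product of H. -/
open MeasureTheory Real Set RealInnerProductSpace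

/-- `omega μ t = t^(μ-1)/Γ(μ)`. -/
noncomputable def omega (μ : ℝ) (t : ℝ) : ℝ := t ^ (μ - 1) / Real.Gamma μ

/-- Riemann–Liouville fractional integral `(I^ν φ)(t) = ∫_0^t ω_ν(t-s) φ(s) ds`. -/
noncomputable def fracInt {X : Type*} [NormedAddCommGroup X] [NormedSpace ℝ X]
    (ν : ℝ) (φ : ℝ → X) (t : ℝ) : X :=
  ∫ s in (0:ℝ)..t, omega ν (t - s) • φ s

/-- The causal power kernel `x ^ (μ - 1)` on `(0, ∞)`, extended by zero. -/
noncomputable def truncPow (μ : ℝ) : ℝ → ℝ := (Ioi 0).indicator fun x => x ^ (μ - 1)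

theorem truncPow_of_pos {μ x : ℝ} (hx : 0 < x) : truncPow μ x = x ^ (μ - 1) :=
  indicator_of_mem (mem_Ioi.2 hx) _

theorem truncPow_of_nonpos {μ x : ℝ} (hx : x ≤ 0) : truncPow μ x = 0 :=
  indicator_of_notMem (notMem_Ioi.2 hx) _

theorem truncPow_nonneg (μ x : ℝ) : 0 ≤ truncPow μ x :=
  indicator_nonneg (fun _ hx => rpow_nonneg (le_of_lt hx) _) x

@[fun_prop]
theorem measurable_truncPow (μ : ℝ) : Measurable (truncPow μ) :=
  Measurable.indicator (by fun_prop) measurableSet_Ioi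

theorem intervalIntegrable_truncPow {μ : ℝ} (hμ : 0 < μ) (a b : ℝ) :
    IntervalIntegrable (truncPow μ) volume a b := by
  have h := intervalIntegral.intervalIntegrable_rpow' (a := a) (b := b)
    (show -1 < μ - 1 by linarith)
  exact ⟨h.1.indicator measurableSet_Ioi, h.2.indicator measurableSet_Ioi⟩

theorem integrableOn_rpow_mul_exp_neg_mul {a r : ℝ} (ha : 0 < a) (hr : 0 < r) :
    IntegrableOn (fun t : ℝ => t ^ (a - 1) * exp (-(r * t))) (Ioi 0) := by
  have := Gamma_pos_of_pos ha
  exact .of_integral_ne_zero (by rw [integral_rpow_mul_exp_neg_mul_Ioi ha hr]; positivity)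

/-- The Beta integral over `(0, d)`. -/
theorem integral_truncPow_mul_truncPow_sub {β d : ℝ} (hβ : 0 < β) (hd : 0 < d) :
    ∫ x, truncPow β x * truncPow β (d - x) =
      Gamma β * Gamma β / Gamma (2 * β) * d ^ (2 * β - 1) := by
  have h1 : ∫ x, truncPow β x * truncPow β (d - x) =
      ∫ x in (0 : ℝ)..d, x ^ (β - 1) * (d - x) ^ (β - 1) := by
    rw [intervalIntegral.integral_of_le hd.le, integral_Ioc_eq_integral_Ioo,
      ← integral_indicator measurableSet_Ioo]
    refine integral_congr_ae (.of_forall fun x => ?_)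
    by_cases hx : x ∈ Ioo 0 d
    · simp only [indicator_of_mem hx]
      rw [truncPow_of_pos hx.1, truncPow_of_pos (sub_pos.2 hx.2)]
    · simp only [indicator_of_notMem hx]
      rcases le_or_gt x 0 with h | h
      · rw [truncPow_of_nonpos h, zero_mul]
      · rw [truncPow_of_nonpos (x := d - x), mul_zero]
        by_contra! h'
        exact hx ⟨h, by linarith⟩
  have h2 := Complex.betaIntegral_scaled β β hd
  rw [Complex.betaIntegral_eq_Gamma_mul_div _ _ (by simpa) (by simpa)] at h2
  have h3 : ∫ x in (0 : ℝ)..d, (x : ℂ) ^ ((β : ℂ) - 1) * ((d : ℂ) - x) ^ ((β : ℂ) - 1) =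
      ((∫ x in (0 : ℝ)..d, x ^ (β - 1) * (d - x) ^ (β - 1) : ℝ) : ℂ) := by
    rw [← intervalIntegral.integral_ofReal]
    refine intervalIntegral.integral_congr fun x hx => ?_
    rw [uIcc_of_le hd.le] at hx
    rw [Complex.ofReal_mul, Complex.ofReal_cpow hx.1, Complex.ofReal_cpow (sub_nonneg.2 hx.2)]
    push_cast
    rfl
  rw [h1]
  rw [h3, ← Complex.ofReal_add, Complex.Gamma_ofReal, Complex.Gamma_ofReal] at h2
  rw [← Complex.ofReal_one, ← Complex.ofReal_sub, ← Complex.ofReal_cpow hd.le] at h2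
  rw [two_mul, mul_comm]
  exact_mod_cast h2

/-- The Beta integral of the second kind, over `(0, ∞)`. -/
theorem integral_rpow_add_mul_rpow {β d : ℝ} (hβ : 0 < β) (hβ' : 2 * β < 1) (hd : 0 < d) :
    ∫ y in Ioi (0 : ℝ), (d + y) ^ (β - 1) * y ^ (β - 1) =
      Gamma β * Gamma (1 - 2 * β) / Gamma (1 - β) * d ^ (2 * β - 1) := by
  have hG := Gamma_pos_of_pos (show 0 < 1 - β by linarith)
  let F : ℝ → ℝ → ℝ := fun y u => y ^ (β - 1) * (u ^ ((1 - β) - 1) * exp (-((d + y) * u)))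
  have inner_u (y : ℝ) (hy : y ∈ Ioi (0 : ℝ)) : ∫ u in Ioi (0 : ℝ), F y u =
      Gamma (1 - β) * ((d + y) ^ (β - 1) * y ^ (β - 1)) := by
    have hdy : 0 < d + y := add_pos hd hy
    simp only [F]
    rw [integral_const_mul, integral_rpow_mul_exp_neg_mul_Ioi (by linarith) hdy, one_div,
      inv_rpow hdy.le, ← rpow_neg hdy.le, neg_sub]
    ring
  have F_eq (u y : ℝ) : F y u = u ^ ((1 - β) - 1) * exp (-(d * u)) *
      (y ^ (β - 1) * exp (-(u * y))) := by
    simp only [F]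
    rw [show -((d + y) * u) = -(d * u) + -(u * y) by ring, exp_add]
    ring
  have inner_y (u : ℝ) (hu : u ∈ Ioi (0 : ℝ)) : ∫ y in Ioi (0 : ℝ), F y u =
      Gamma β * (u ^ ((1 - 2 * β) - 1) * exp (-(d * u))) := by
    have hu' : 0 < u := hu
    simp only [F_eq]
    rw [integral_const_mul, integral_rpow_mul_exp_neg_mul_Ioi hβ hu, one_div,
      inv_rpow hu'.le, ← rpow_neg hu'.le,
      show 1 - 2 * β - 1 = (1 - β - 1) + -β by ring, rpow_add hu']
    ring
  have F_nonneg (u : ℝ) (hu : u ∈ Ioi (0 : ℝ)) (y : ℝ) (hy : y ∈ Ioi (0 : ℝ)) : 0 ≤ F y u := by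
    have hu' : 0 < u := hu
    have hy' : 0 < y := hy
    positivity
  have hint : Integrable (Function.uncurry F)
      ((volume.restrict (Ioi 0)).prod (volume.restrict (Ioi 0))) := by
    rw [integrable_prod_iff' (by fun_prop)]
    constructor
    · refine (ae_restrict_mem measurableSet_Ioi).mono fun u hu => ?_
      simp only [Function.uncurry, F_eq]
      exact (integrableOn_rpow_mul_exp_neg_mul hβ hu).const_mul _
    · refine ((integrableOn_rpow_mul_exp_neg_mul (a := 1 - 2 * β) (by linarith) hd).const_mul
        (Gamma β)).congr ?_
      refine (ae_restrict_mem measurableSet_Ioi).mono fun u hu => ?_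
      dsimp only
      rw [← inner_y u hu]
      refine setIntegral_congr_fun measurableSet_Ioi fun y hy => ?_
      exact (norm_of_nonneg (F_nonneg u hu y hy)).symm
  have h := integral_integral_swap hint
  rw [setIntegral_congr_fun measurableSet_Ioi inner_u,
    setIntegral_congr_fun measurableSet_Ioi inner_y, integral_const_mul, integral_const_mul,
    integral_rpow_mul_exp_neg_mul_Ioi (by linarith) hd, one_div, inv_rpow hd.le,
    ← rpow_neg hd.le, neg_sub] at h
  rw [div_mul_eq_mul_div, eq_div_iff hG.ne']
  linarith

theorem integral_truncPow_mul_truncPow_add {β d : ℝ} (hβ : 0 < β) (hβ' : 2 * β < 1)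
    (hd : 0 < d) :
    ∫ x, truncPow β (d + x) * truncPow β x =
      Gamma β * Gamma (1 - 2 * β) / Gamma (1 - β) * d ^ (2 * β - 1) := by
  rw [← integral_rpow_add_mul_rpow hβ hβ' hd, ← integral_indicator measurableSet_Ioi]
  refine integral_congr_ae (.of_forall fun x => ?_)
  by_cases hx : x ∈ Ioi 0
  · simp only [indicator_of_mem hx]
    rw [truncPow_of_pos hx, truncPow_of_pos (add_pos hd hx)]
  · simp only [indicator_of_notMem hx]
    rw [truncPow_of_nonpos (not_lt.1 hx), mul_zero]

theorem integral_truncPow_sub_mul_truncPow_sub {β : ℝ} (hβ : 0 < β) (τ σ : ℝ) :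
    Integrable (fun r => truncPow β (r - τ) * truncPow β (σ - r)) ∧
      ∫ r, truncPow β (r - τ) * truncPow β (σ - r) =
        Gamma β * Gamma β / Gamma (2 * β) * truncPow (2 * β) (σ - τ) := by
  rcases le_or_gt σ τ with h | h
  · have h0 : (fun r => truncPow β (r - τ) * truncPow β (σ - r)) = fun _ => 0 := by
      funext r
      rcases le_or_gt r τ with h' | h'
      · rw [truncPow_of_nonpos (by linarith), zero_mul]
      · rw [truncPow_of_nonpos (x := σ - r) (by linarith), mul_zero]
    rw [h0, truncPow_of_nonpos (by linarith)]
    simp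
  · have h0 : 0 < σ - τ := sub_pos.2 h
    have hv : ∫ r, truncPow β (r - τ) * truncPow β (σ - r) =
        Gamma β * Gamma β / Gamma (2 * β) * truncPow (2 * β) (σ - τ) := by
      rw [truncPow_of_pos h0, ← integral_truncPow_mul_truncPow_sub hβ h0,
        ← integral_sub_right_eq_self (fun x => truncPow β x * truncPow β (σ - τ - x)) τ]
      simp
    refine ⟨.of_integral_ne_zero ?_, hv⟩
    have := Gamma_pos_of_pos hβ
    have := Gamma_pos_of_pos (show 0 < 2 * β by linarith)
    rw [hv, truncPow_of_pos h0]
    positivity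

theorem integral_truncPow_sub_mul_truncPow_sub_of_lt {β τ σ : ℝ} (hβ : 0 < β) (hβ' : 2 * β < 1)
    (h : τ < σ) :
    Integrable (fun r => truncPow β (r - τ) * truncPow β (r - σ)) ∧
      ∫ r, truncPow β (r - τ) * truncPow β (r - σ) =
        Gamma β * Gamma (1 - 2 * β) / Gamma (1 - β) * truncPow (2 * β) (σ - τ) := by
  have h0 : 0 < σ - τ := sub_pos.2 h
  have hv : ∫ r, truncPow β (r - τ) * truncPow β (r - σ) =
      Gamma β * Gamma (1 - 2 * β) / Gamma (1 - β) * truncPow (2 * β) (σ - τ) := by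
    rw [truncPow_of_pos h0, ← integral_truncPow_mul_truncPow_add hβ hβ' h0,
      ← integral_sub_right_eq_self (fun x => truncPow β (σ - τ + x) * truncPow β x) σ]
    congr! 3 with r
    congr 1
    ring
  refine ⟨.of_integral_ne_zero ?_, hv⟩
  have := Gamma_pos_of_pos hβ
  have := Gamma_pos_of_pos (show 0 < 1 - 2 * β by linarith)
  have := Gamma_pos_of_pos (show 0 < 1 - β by linarith)
  rw [hv, truncPow_of_pos h0]
  positivity

theorem integral_truncPow_sub_mul_truncPow_sub_of_ne {β τ σ : ℝ} (hβ : 0 < β) (hβ' : 2 * β < 1)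
    (h : τ ≠ σ) :
    Integrable (fun r => truncPow β (r - τ) * truncPow β (r - σ)) ∧
      ∫ r, truncPow β (r - τ) * truncPow β (r - σ) =
        Gamma β * Gamma (1 - 2 * β) / Gamma (1 - β) *
          (truncPow (2 * β) (σ - τ) + truncPow (2 * β) (τ - σ)) := by
  rcases h.lt_or_gt with h | h
  · rw [truncPow_of_nonpos (x := τ - σ) (by linarith), add_zero]
    exact integral_truncPow_sub_mul_truncPow_sub_of_lt hβ hβ' h
  · rw [truncPow_of_nonpos (x := σ - τ) (by linarith), zero_add]
    simp only [mul_comm (truncPow β (_ - τ))]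
    exact integral_truncPow_sub_mul_truncPow_sub_of_lt hβ hβ' h

/-- Reflected version of `integral_truncPow_sub_mul_truncPow_sub_of_ne`. -/
theorem integral_truncPow_sub_mul_truncPow_sub_of_ne' {β τ σ : ℝ} (hβ : 0 < β)
    (hβ' : 2 * β < 1) (h : τ ≠ σ) :
    Integrable (fun r => truncPow β (τ - r) * truncPow β (σ - r)) ∧
      ∫ r, truncPow β (τ - r) * truncPow β (σ - r) =
        Gamma β * Gamma (1 - 2 * β) / Gamma (1 - β) *
          (truncPow (2 * β) (σ - τ) + truncPow (2 * β) (τ - σ)) := by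
  obtain ⟨hi, hv⟩ := integral_truncPow_sub_mul_truncPow_sub_of_ne (τ := -τ) (σ := -σ) hβ hβ'
    (neg_injective.ne h)
  have e (r x : ℝ) : truncPow β (x - r) = truncPow β (-r - -x) := by congr 1; ring
  simp only [e _ τ, e _ σ]
  refine ⟨hi.comp_neg, ?_⟩
  rw [integral_neg_eq_self (fun r => truncPow β (r - -τ) * truncPow β (r - -σ)), hv,
    neg_sub_neg, neg_sub_neg, add_comm]

section

variable {H : Type*} [NormedAddCommGroup H] [InnerProductSpace ℝ H]

theorem integral_prod_inner [CompleteSpace H] {X Y : Type*} [MeasurableSpace X]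
    [MeasurableSpace Y] {μ : Measure X} {ν : Measure Y} [SFinite μ] [SFinite ν]
    {f : X → H} {g : Y → H} (hf : Integrable f μ) (hg : Integrable g ν) :
    ∫ p, ⟪f p.1, g p.2⟫ ∂μ.prod ν = ⟪∫ x, f x ∂μ, ∫ y, g y ∂ν⟫ := by
  have hfg : Integrable (fun p : X × Y => ⟪f p.1, g p.2⟫) (μ.prod ν) :=
    hf.op_fst_snd (op := fun x y => ⟪x, y⟫) (by fun_prop)
      ⟨1, fun x y => by simpa using norm_inner_le_norm (𝕜 := ℝ) x y⟩ hg
  rw [integral_prod _ hfg]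
  simp_rw [integral_inner hg, real_inner_comm (∫ y, g y ∂ν), integral_inner hf]

theorem ae_norm_inner_le_mul {X Y : Type*} [MeasurableSpace X] [MeasurableSpace Y]
    {μ : Measure X} {ν : Measure Y} [SFinite ν] {f : X → H} {g : Y → H} {M N : ℝ}
    (hf : ∀ᵐ x ∂μ, ‖f x‖ ≤ M) (hg : ∀ᵐ y ∂ν, ‖g y‖ ≤ N) :
    ∀ᵐ p ∂μ.prod ν, ‖⟪f p.1, g p.2⟫‖ ≤ M * N := by
  filter_upwards [Measure.quasiMeasurePreserving_fst.ae hf,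
    Measure.quasiMeasurePreserving_snd.ae hg] with p h1 h2
  exact (norm_inner_le_norm _ _).trans
    (mul_le_mul h1 h2 (norm_nonneg _) ((norm_nonneg _).trans h1))

/-- If `∫ k(r, τ) l(r, σ) dr = K(τ, σ)`, then pairing the integral operators with kernels `k` and
`l` amounts to integrating against `K`. -/
theorem integral_inner_integral_smul [CompleteSpace H] {μ : Measure ℝ} [IsFiniteMeasure μ]
    {f g : ℝ → H} {M N : ℝ}
    (hf : AEStronglyMeasurable f μ) (hfM : ∀ᵐ x ∂μ, ‖f x‖ ≤ M)
    (hg : AEStronglyMeasurable g μ) (hgN : ∀ᵐ x ∂μ, ‖g x‖ ≤ N)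
    {k l : ℝ → ℝ → ℝ} (hk : Measurable (Function.uncurry k)) (hl : Measurable (Function.uncurry l))
    (hk0 : ∀ r τ, 0 ≤ k r τ) (hl0 : ∀ r σ, 0 ≤ l r σ)
    (hki : ∀ r, Integrable (k r) μ) (hli : ∀ r, Integrable (l r) μ)
    {K : ℝ × ℝ → ℝ} (hK : Integrable K (μ.prod μ))
    (hkl : ∀ᵐ p ∂μ.prod μ, Integrable (fun r => k r p.1 * l r p.2) ∧
      ∫ r, k r p.1 * l r p.2 = K p) :
    Integrable (fun r => ⟪∫ τ, k r τ • f τ ∂μ, ∫ σ, l r σ • g σ ∂μ⟫) ∧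
      ∫ r, ⟪∫ τ, k r τ • f τ ∂μ, ∫ σ, l r σ • g σ ∂μ⟫ =
        ∫ p, K p * ⟪f p.1, g p.2⟫ ∂μ.prod μ := by
  have hfg : AEStronglyMeasurable (fun p : ℝ × ℝ => ⟪f p.1, g p.2⟫) (μ.prod μ) :=
    hf.comp_fst.inner hg.comp_snd
  have hbound : ∀ᵐ p ∂μ.prod μ, ‖⟪f p.1, g p.2⟫‖ ≤ M * N :=
    ae_norm_inner_le_mul hfM hgN
  let F : ℝ × ℝ × ℝ → ℝ := fun q => k q.1 q.2.1 * l q.1 q.2.2 * ⟪f q.2.1, g q.2.2⟫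
  have hk' : Measurable fun q : ℝ × ℝ × ℝ => k q.1 q.2.1 :=
    hk.comp (measurable_fst.prodMk measurable_snd.fst)
  have hl' : Measurable fun q : ℝ × ℝ × ℝ => l q.1 q.2.2 :=
    hl.comp (measurable_fst.prodMk measurable_snd.snd)
  have hFm : AEStronglyMeasurable F (volume.prod (μ.prod μ)) :=
    (hk'.mul hl').aestronglyMeasurable.mul hfg.comp_snd
  have hF : Integrable F (volume.prod (μ.prod μ)) := by
    rw [integrable_prod_iff' hFm]
    constructor
    · filter_upwards [hkl] with p hp using hp.1.mul_const ⟪f p.1, g p.2⟫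
    · refine (hK.mul_bdd hfg.norm (c := M * N) (by simpa using hbound)).congr ?_
      filter_upwards [hkl] with p hp
      rw [← hp.2, ← integral_mul_const]
      refine integral_congr_ae (.of_forall fun r => ?_)
      simp only [F, norm_mul, norm_of_nonneg (hk0 _ _), norm_of_nonneg (hl0 _ _)]
  have hFr (r : ℝ) : ∫ p, F (r, p) ∂μ.prod μ =
      ⟪∫ τ, k r τ • f τ ∂μ, ∫ σ, l r σ • g σ ∂μ⟫ := by
    rw [← integral_prod_inner (f := fun τ => k r τ • f τ) (g := fun σ => l r σ • g σ)
      ((hki r).smul_bdd M hf hfM) ((hli r).smul_bdd N hg hgN)]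
    refine integral_congr_ae (.of_forall fun p => ?_)
    simp only [F, real_inner_smul_left, real_inner_smul_right]
    ring
  simp only [← hFr]
  refine ⟨hF.integral_prod_left, ?_⟩
  rw [← integral_prod _ hF, integral_prod_symm _ hF]
  refine integral_congr_ae ?_
  filter_upwards [hkl] with p hp
  rw [← hp.2, ← integral_mul_const]

theorem integrable_truncPow_sub {μ : ℝ} (hμ : 0 < μ) (t : ℝ) :
    Integrable (fun p : ℝ × ℝ => truncPow μ (p.2 - p.1))
      ((volume.restrict (Ioc 0 t)).prod (volume.restrict (Ioc 0 t))) := by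
  have h1 : Integrable ((Ioc (0 : ℝ) t).indicator fun _ => (1 : ℝ)) :=
    (integrable_indicator_iff measurableSet_Ioc).2 (by simp)
  have h2 : Integrable ((Ioc (0 : ℝ) t).indicator (truncPow μ)) :=
    (integrable_indicator_iff measurableSet_Ioc).2 (intervalIntegrable_truncPow hμ 0 t).1
  have h3 := (h1.convolution_integrand (ContinuousLinearMap.mul ℝ ℝ) h2).swap
  rw [Measure.prod_restrict]
  refine IntegrableOn.congr_fun (h3.integrableOn (s := Ioc 0 t ×ˢ Ioc 0 t)) ?_
    (measurableSet_Ioc.prod measurableSet_Ioc)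
  rintro ⟨τ, σ⟩ ⟨hτ, hσ⟩
  simp only [mem_Ioc] at hτ hσ
  simp only [Function.comp, Prod.swap, ContinuousLinearMap.mul_apply']
  rw [indicator_of_mem (by simpa using hτ), one_mul]
  rcases le_or_gt σ τ with h | h
  · rw [indicator_of_notMem (fun h' => by linarith [h'.1]), truncPow_of_nonpos (by linarith)]
  · rw [indicator_of_mem (mem_Ioc.2 ⟨by linarith, by linarith⟩)]

theorem integral_inner_fracInt [CompleteSpace H] {ν T t : ℝ} (hν : 0 < ν) {f g : ℝ → H}
    (hf : ContinuousOn f (Icc 0 T)) (hg : ContinuousOn g (Icc 0 T)) (ht : t ∈ Icc 0 T) :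
    Gamma ν * ∫ s in (0 : ℝ)..t, ⟪fracInt ν f s, g s⟫ =
      ∫ p, truncPow ν (p.2 - p.1) * ⟪f p.1, g p.2⟫
        ∂(volume.restrict (Ioc 0 t)).prod (volume.restrict (Ioc 0 t)) := by
  have hsub : Ioc 0 t ⊆ Icc 0 T := Ioc_subset_Icc_self.trans (Icc_subset_Icc_right ht.2)
  obtain ⟨M, hM⟩ := isCompact_Icc.exists_bound_of_continuousOn hf
  obtain ⟨N, hN⟩ := isCompact_Icc.exists_bound_of_continuousOn hg
  have hfm : AEStronglyMeasurable f (volume.restrict (Ioc 0 t)) :=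
    (hf.mono hsub).aestronglyMeasurable measurableSet_Ioc
  have hgm : AEStronglyMeasurable g (volume.restrict (Ioc 0 t)) :=
    (hg.mono hsub).aestronglyMeasurable measurableSet_Ioc
  have hfM : ∀ᵐ x ∂volume.restrict (Ioc 0 t), ‖f x‖ ≤ M :=
    (ae_restrict_mem measurableSet_Ioc).mono fun x hx => hM x (hsub hx)
  have hgN : ∀ᵐ x ∂volume.restrict (Ioc 0 t), ‖g x‖ ≤ N :=
    (ae_restrict_mem measurableSet_Ioc).mono fun x hx => hN x (hsub hx)
  have hbound : ∀ᵐ p ∂(volume.restrict (Ioc 0 t)).prod (volume.restrict (Ioc 0 t)),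
      ‖⟪f p.1, g p.2⟫‖ ≤ M * N :=
    ae_norm_inner_le_mul hfM hgN
  rw [integral_prod_symm _ ((integrable_truncPow_sub hν t).mul_bdd
      (hfm.comp_fst.inner hgm.comp_snd) hbound),
    intervalIntegral.integral_of_le ht.1, ← integral_const_mul]
  refine setIntegral_congr_fun measurableSet_Ioc fun s hs => ?_
  have hker : Integrable (fun τ => truncPow ν (s - τ)) (volume.restrict (Ioc 0 t)) := by
    have := (intervalIntegrable_truncPow hν (s - 0) (s - t)).comp_sub_left s
    simpa [IntegrableOn] using this.1
  have hfrac : Gamma ν • fracInt ν f s = ∫ τ in Ioc 0 t, truncPow ν (s - τ) • f τ := by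
    have hG := Gamma_pos_of_pos hν
    rw [fracInt, intervalIntegral.integral_of_le hs.1.le, ← integral_smul,
      integral_Ioc_eq_integral_Ioo,
      setIntegral_eq_of_subset_of_forall_sdiff_eq_zero (s := Ioo 0 s) (t := Ioc 0 t)
        (f := fun τ => truncPow ν (s - τ) • f τ) measurableSet_Ioc
        (Ioo_subset_Ioc_self.trans (Ioc_subset_Ioc_right hs.2))]
    · refine setIntegral_congr_fun measurableSet_Ioo fun τ hτ => ?_
      simp only [omega, smul_smul]
      rw [truncPow_of_pos (sub_pos.2 hτ.2), mul_div_cancel₀ _ hG.ne']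
    · intro τ hτ
      rw [truncPow_of_nonpos, zero_smul]
      by_contra! h
      exact hτ.2 ⟨hτ.1.1, by linarith⟩
  dsimp only
  rw [← real_inner_smul_left, hfrac, real_inner_comm,
    ← integral_inner (f := fun τ => truncPow ν (s - τ) • f τ) (hker.smul_bdd M hfm hfM)]
  simp only [real_inner_smul_right, real_inner_comm (g s)]

theorem ae_prod_fst_ne_snd {μ ν : Measure ℝ} [SFinite ν] [NullSingletonClass ν] :
    ∀ᵐ p ∂μ.prod ν, p.1 ≠ p.2 := by
  rw [ae_iff]
  simp only [not_not]
  rw [Measure.measure_prod_null (measurableSet_eq_fun measurable_fst measurable_snd)]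
  refine .of_forall fun x => ?_
  have : Prod.mk x ⁻¹' {p : ℝ × ℝ | p.1 = p.2} = {x} := by
    ext y; simp [eq_comm]
  simp [this]

theorem integral_symm_kernel_mul_inner {μ : Measure ℝ} [SFinite μ] {f : ℝ → H} {K : ℝ × ℝ → ℝ}
    (hK : Integrable (fun p => K p * ⟪f p.1, f p.2⟫) (μ.prod μ)) (C : ℝ) :
    ∫ p, C * (K p + K p.swap) * ⟪f p.1, f p.2⟫ ∂μ.prod μ =
      2 * C * ∫ p, K p * ⟪f p.1, f p.2⟫ ∂μ.prod μ := by
  have h1 : ∫ p, K p.swap * ⟪f p.1, f p.2⟫ ∂μ.prod μ = ∫ p, K p * ⟪f p.1, f p.2⟫ ∂μ.prod μ := by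
    rw [← integral_prod_swap]
    simp [real_inner_comm]
  have h2 : Integrable (fun p => K p.swap * ⟪f p.1, f p.2⟫) (μ.prod μ) :=
    hK.swap.congr (.of_forall fun p => by simp [real_inner_comm])
  simp only [mul_assoc, add_mul]
  rw [integral_const_mul, integral_add hK h2, h1]
  ring

theorem inner_le_mul_inner_self_add {δ : ℝ} (hδ : 0 < δ) (a b : H) :
    ⟪a, b⟫ ≤ δ * ⟪a, a⟫ + 1 / (4 * δ) * ⟪b, b⟫ := by
  have h : 0 ≤ ⟪(2 * δ) • a - b, (2 * δ) • a - b⟫ := real_inner_self_nonneg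
  simp only [inner_sub_left, inner_sub_right, real_inner_smul_left, real_inner_smul_right,
    real_inner_comm a b] at h
  have e : δ * ⟪a, a⟫ + 1 / (4 * δ) * ⟪b, b⟫ - ⟪a, b⟫ =
      (2 * δ * (2 * δ * ⟪a, a⟫) - 2 * δ * ⟪a, b⟫ - (2 * δ * ⟪a, b⟫ - ⟪b, b⟫)) / (4 * δ) := by
    field_simp
    ring
  have := div_nonneg h (show 0 ≤ 4 * δ by positivity)
  linarith

end

theorem two_mul_Gamma_mul_Gamma_div_Gamma {β : ℝ} (hβ : 0 < β) (hβ' : 2 * β < 1) :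
    2 * (Gamma β * Gamma (1 - 2 * β) / Gamma (1 - β)) =
      Gamma β * Gamma β / Gamma (2 * β) / cos (π * β) := by
  have hs : 0 < sin (π * β) := sin_pos_of_pos_of_lt_pi (by positivity) (by nlinarith [pi_pos])
  have hc : 0 < cos (π * β) := cos_pos_of_mem_Ioo ⟨by nlinarith [pi_pos], by nlinarith [pi_pos]⟩
  have h1 := Gamma_mul_Gamma_one_sub β
  have h2 := Gamma_mul_Gamma_one_sub (2 * β)
  rw [show π * (2 * β) = 2 * (π * β) by ring, sin_two_mul] at h2
  have g1 := Gamma_pos_of_pos hβ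
  have g2 := Gamma_pos_of_pos (show 0 < 2 * β by linarith)
  have g3 := Gamma_pos_of_pos (show 0 < 1 - β by linarith)
  rw [div_div, mul_div_assoc', div_eq_div_iff g3.ne' (mul_pos g2 hc).ne']
  calc _ = Gamma β * (2 * cos (π * β) * (Gamma (2 * β) * Gamma (1 - 2 * β))) := by ring
    _ = Gamma β * (Gamma β * Gamma (1 - β)) := by rw [h1, h2]; field_simp
    _ = _ := by ring

theorem le_cos_pi_mul_half_one_sub {α : ℝ} (hα0 : 0 ≤ α) (hα1 : α ≤ 1) :
    α ≤ cos (π * ((1 - α) / 2)) := by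
  have h := mul_le_sin (x := π * α / 2) (by positivity) (by nlinarith [pi_pos])
  rw [show π * ((1 - α) / 2) = π / 2 - π * α / 2 by ring, cos_pi_div_two_sub]
  calc α = 2 / π * (π * α / 2) := by field_simp
    _ ≤ _ := h

theorem stmt_0 {H : Type*} [NormedAddCommGroup H] [InnerProductSpace ℝ H] [CompleteSpace H]
    {α T : ℝ} (hα0 : 0 < α) (hα1 : α < 1) (hT : 0 < T)
    {φ ψ : ℝ → H} (hφ : ContinuousOn φ (Set.Icc 0 T)) (hψ : ContinuousOn ψ (Set.Icc 0 T))
    {ε : ℝ} (hε : 0 < ε) {t : ℝ} (ht : t ∈ Set.Icc (0:ℝ) T) :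
    (∫ s in (0:ℝ)..t, ⟪fracInt (1 - α) φ s, ψ s⟫) ≤
      ε * (∫ s in (0:ℝ)..t, ⟪fracInt (1 - α) φ s, φ s⟫) +
        (1 / (4 * ε * α ^ 2)) * ∫ s in (0:ℝ)..t, ⟪fracInt (1 - α) ψ s, ψ s⟫ := by
  obtain ⟨β, hβ⟩ : ∃ β, (1 - α) / 2 = β := ⟨_, rfl⟩
  have hν : 1 - α = 2 * β := by linarith
  have hβ0 : 0 < β := by linarith
  have hβ1 : 2 * β < 1 := by linarith
  have hν0 : 0 < 2 * β := by linarith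
  have hc : α ≤ cos (π * β) := hβ ▸ le_cos_pi_mul_half_one_sub hα0.le hα1.le
  obtain ⟨c, hcos⟩ : ∃ c, cos (π * β) = c := ⟨_, rfl⟩
  rw [hcos] at hc
  have hc0 : 0 < c := hα0.trans_le hc
  have hG := Gamma_pos_of_pos hν0
  have hGβ := Gamma_pos_of_pos hβ0
  have hsub : Ioc 0 t ⊆ Icc 0 T := Ioc_subset_Icc_self.trans (Icc_subset_Icc_right ht.2)
  obtain ⟨M, hM⟩ := isCompact_Icc.exists_bound_of_continuousOn hφ
  obtain ⟨N, hN⟩ := isCompact_Icc.exists_bound_of_continuousOn hψ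
  have hφm : AEStronglyMeasurable φ (volume.restrict (Ioc 0 t)) :=
    (hφ.mono hsub).aestronglyMeasurable measurableSet_Ioc
  have hψm : AEStronglyMeasurable ψ (volume.restrict (Ioc 0 t)) :=
    (hψ.mono hsub).aestronglyMeasurable measurableSet_Ioc
  have hφM : ∀ᵐ x ∂volume.restrict (Ioc 0 t), ‖φ x‖ ≤ M :=
    (ae_restrict_mem measurableSet_Ioc).mono fun x hx => hM x (hsub hx)
  have hψN : ∀ᵐ x ∂volume.restrict (Ioc 0 t), ‖ψ x‖ ≤ N :=
    (ae_restrict_mem measurableSet_Ioc).mono fun x hx => hN x (hsub hx)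
  have hKi := integrable_truncPow_sub hν0 t
  have hφφ := integral_inner_fracInt hν0 hφ hφ ht
  have hφψ := integral_inner_fracInt hν0 hφ hψ ht
  have hψψ := integral_inner_fracInt hν0 hψ hψ ht
  have hkmeas : Measurable (Function.uncurry fun r τ : ℝ => truncPow β (r - τ)) := by
    unfold Function.uncurry; fun_prop
  have hlmeas : Measurable (Function.uncurry fun r σ : ℝ => truncPow β (σ - r)) := by
    unfold Function.uncurry; fun_prop
  have hki (r : ℝ) : Integrable (fun τ => truncPow β (r - τ)) (volume.restrict (Ioc 0 t)) := by
    have := (intervalIntegrable_truncPow hβ0 (r - 0) (r - t)).comp_sub_left r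
    simpa [IntegrableOn] using this.1
  have hli (r : ℝ) : Integrable (fun σ => truncPow β (σ - r)) (volume.restrict (Ioc 0 t)) := by
    have := (intervalIntegrable_truncPow hβ0 (0 - r) (t - r)).comp_sub_right r
    simpa [IntegrableOn] using this.1
  obtain ⟨i12, e12⟩ := integral_inner_integral_smul hφm hφM hψm hψN hkmeas hlmeas
    (fun _ _ => truncPow_nonneg _ _) (fun _ _ => truncPow_nonneg _ _) hki hli
    (hKi.const_mul (Gamma β * Gamma β / Gamma (2 * β)))
    (.of_forall fun p => integral_truncPow_sub_mul_truncPow_sub hβ0 p.1 p.2)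
  have hKi2 := (hKi.add hKi.swap).const_mul (Gamma β * Gamma (1 - 2 * β) / Gamma (1 - β))
  obtain ⟨i11, e11⟩ := integral_inner_integral_smul hφm hφM hφm hφM hkmeas hkmeas
    (fun _ _ => truncPow_nonneg _ _) (fun _ _ => truncPow_nonneg _ _) hki hki hKi2
    (ae_prod_fst_ne_snd.mono fun p hp =>
      integral_truncPow_sub_mul_truncPow_sub_of_ne hβ0 hβ1 hp)
  obtain ⟨i22, e22⟩ := integral_inner_integral_smul hψm hψN hψm hψN hlmeas hlmeas
    (fun _ _ => truncPow_nonneg _ _) (fun _ _ => truncPow_nonneg _ _) hli hli hKi2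
    (ae_prod_fst_ne_snd.mono fun p hp =>
      integral_truncPow_sub_mul_truncPow_sub_of_ne' hβ0 hβ1 hp)
  have s1 := integral_symm_kernel_mul_inner (hKi.mul_bdd (hφm.comp_fst.inner hφm.comp_snd)
    (ae_norm_inner_le_mul hφM hφM)) (Gamma β * Gamma (1 - 2 * β) / Gamma (1 - β))
  have s2 := integral_symm_kernel_mul_inner (hKi.mul_bdd (hψm.comp_fst.inner hψm.comp_snd)
    (ae_norm_inner_le_mul hψN hψN)) (Gamma β * Gamma (1 - 2 * β) / Gamma (1 - β))
  replace e11 := e11.trans s1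
  replace e22 := e22.trans s2
  simp only [mul_assoc (Gamma β * Gamma β / Gamma (2 * β))] at e12
  rw [integral_const_mul, ← hφψ] at e12
  rw [← hφφ, two_mul_Gamma_mul_Gamma_div_Gamma hβ0 hβ1, hcos] at e11
  rw [← hψψ, two_mul_Gamma_mul_Gamma_div_Gamma hβ0 hβ1, hcos] at e22
  have hδ : 0 < ε * c := mul_pos hε hc0
  have young := integral_mono i12 ((i11.const_mul (ε * c)).add (i22.const_mul (1 / (4 * (ε * c)))))
    fun r => inner_le_mul_inner_self_add hδ _ _
  have nonneg : 0 ≤ ∫ r, ⟪∫ σ in Ioc 0 t, truncPow β (σ - r) • ψ σ,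
      ∫ σ in Ioc 0 t, truncPow β (σ - r) • ψ σ⟫ :=
    integral_nonneg fun r => real_inner_self_nonneg
  simp only [Pi.add_apply] at young
  rw [integral_add (i11.const_mul _) (i22.const_mul _), integral_const_mul, integral_const_mul,
    e11, e22, e12] at young
  rw [e22] at nonneg
  rw [hν]
  generalize (∫ s in (0:ℝ)..t, ⟪fracInt (2 * β) φ s, ψ s⟫) = X at *
  generalize (∫ s in (0:ℝ)..t, ⟪fracInt (2 * β) φ s, φ s⟫) = Y at *
  generalize (∫ s in (0:ℝ)..t, ⟪fracInt (2 * β) ψ s, ψ s⟫) = Z at *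
  have hZ : 0 ≤ Z := by
    rw [← mul_assoc] at nonneg
    exact nonneg_of_mul_nonneg_right nonneg (by positivity)
  have hX : X ≤ ε * Y + 1 / (4 * ε * c ^ 2) * Z := by
    refine le_of_mul_le_mul_left ?_ (mul_pos hGβ hGβ)
    convert young using 1 <;> field_simp
  refine hX.trans ?_
  gcongr
end

section
/- Let H be a real Hilbert space, let 0 < α < 1 and T > 0, and let φ : [0,T] → H be continuous with φ(0) = 0 and continuously differentiable on (0,T], and suppose there are constants C ≥ 0 and 0 ≤ μ < 1 - α such that ‖φ'(t)‖ ≤ C t^{-μ} for 0 < t ≤ T. Then for every t ∈ (0,T], ‖φ(t)‖² ≤ 2 ω_{1+α}(t) ∫_0^t ⟨(I^{1-α}φ')(s), φ'(s)⟩ ds. -/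
open MeasureTheory Real Set RealInnerProductSpace

lemma integral_rpow_div_add_mul {α a t : ℝ} (hα0 : 0 < α) (hα1 : α < 1) (ha : 0 < a)
    (ht : 0 < t) :
    ∫ l in Ioi (0:ℝ), l ^ (α - 1) * (1 / (a + l * t)) =
      Real.Gamma α * Real.Gamma (1 - α) * (a ^ (α - 1) * t ^ (-α)) := by
  have inner_l : ∀ u ∈ Ioi (0:ℝ),
      ∫ l in Ioi (0:ℝ), l ^ (α - 1) * exp (-((a + l * t) * u)) =
        Real.Gamma α * t ^ (-α) * (u ^ ((1 - α) - 1) * exp (-(a * u))) := by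
    intro u hu
    have hu : 0 < u := hu
    have h := Real.integral_rpow_mul_exp_neg_mul_Ioi hα0 (mul_pos ht hu)
    have e : ∀ l : ℝ, l ^ (α - 1) * exp (-((a + l * t) * u)) =
        exp (-(a * u)) * (l ^ (α - 1) * exp (-(t * u * l))) := by
      intro l
      rw [mul_left_comm, ← Real.exp_add]
      ring_nf
    simp_rw [e]
    rw [integral_const_mul, h, one_div, Real.inv_rpow (by positivity), ← Real.rpow_neg (by positivity),
      Real.mul_rpow ht.le hu.le]
    ring_nf
  have inner_u : ∀ l ∈ Ioi (0:ℝ),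
      ∫ u in Ioi (0:ℝ), l ^ (α - 1) * exp (-((a + l * t) * u)) =
        l ^ (α - 1) * (1 / (a + l * t)) := by
    intro l hl
    have hl : 0 < l := hl
    have h := Real.integral_rpow_mul_exp_neg_mul_Ioi one_pos (show 0 < a + l * t by positivity)
    rw [integral_const_mul]
    simp only [sub_self, Real.rpow_zero, one_mul, Real.rpow_one, Real.Gamma_one, mul_one] at h
    rw [h]
  have hmeas : AEStronglyMeasurable
      (fun p : ℝ × ℝ => p.2 ^ (α - 1) * exp (-((a + p.2 * t) * p.1)))
      ((volume.restrict (Ioi 0)).prod (volume.restrict (Ioi 0))) := by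
    apply Measurable.aestronglyMeasurable
    fun_prop
  have hint : Integrable (Function.uncurry fun u l : ℝ => l ^ (α - 1) * exp (-((a + l * t) * u)))
      ((volume.restrict (Ioi 0)).prod (volume.restrict (Ioi 0))) := by
    refine (integrable_prod_iff hmeas).2 ⟨?_, ?_⟩
    · filter_upwards [ae_restrict_mem measurableSet_Ioi] with u hu
      by_contra hn
      have h := inner_l u hu
      have hu : 0 < u := hu
      rw [integral_undef hn] at h
      have : 0 < Real.Gamma α := Real.Gamma_pos_of_pos hα0
      exact absurd h (by positivity)
    · have hE : Integrable (fun u : ℝ => Real.Gamma α * t ^ (-α) *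
          (u ^ ((1 - α) - 1) * exp (-(a * u)))) (volume.restrict (Ioi 0)) := by
        apply Integrable.const_mul
        by_contra hn
        have h := Real.integral_rpow_mul_exp_neg_mul_Ioi (sub_pos.2 hα1) ha
        rw [integral_undef hn] at h
        have : 0 < Real.Gamma (1 - α) := Real.Gamma_pos_of_pos (sub_pos.2 hα1)
        exact absurd h (by positivity)
      refine hE.congr ?_
      filter_upwards [ae_restrict_mem measurableSet_Ioi] with u hu
      rw [← inner_l u hu]
      refine setIntegral_congr_fun measurableSet_Ioi fun l hl => ?_
      have hl : 0 < l := hl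
      exact (Real.norm_of_nonneg (by positivity)).symm
  have hswap := integral_integral_swap hint
  rw [setIntegral_congr_fun measurableSet_Ioi inner_l,
    setIntegral_congr_fun measurableSet_Ioi inner_u, integral_const_mul,
    Real.integral_rpow_mul_exp_neg_mul_Ioi (sub_pos.2 hα1) ha] at hswap
  rw [← hswap, one_div, Real.inv_rpow ha.le, ← Real.rpow_neg ha.le]
  ring_nf

section

variable {H : Type*} [NormedAddCommGroup H] [InnerProductSpace ℝ H]

lemma norm_sq_div_le_integral_exp_kernel [CompleteSpace H] {φ φ' : ℝ → H} {t l : ℝ} (ht : 0 < t) (hl : 0 < l)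
    (hcont : ContinuousOn φ (Icc 0 t)) (hzero : φ 0 = 0)
    (hderiv : ∀ s ∈ Ioo 0 t, HasDerivAt φ (φ' s) s) (hc : ContinuousOn φ' (Ioo 0 t))
    (hint : IntervalIntegrable φ' volume 0 t) :
    ‖φ t‖ ^ 2 * (1 / (2 + l * t)) ≤
      ∫ s in (0:ℝ)..t, ⟪∫ r in (0:ℝ)..s, exp (-(l * (s - r))) • φ' r, φ' s⟫ := by
  set y : ℝ → H := fun s => ∫ r in (0:ℝ)..s, exp (-(l * (s - r))) • φ' r with hy
  have hy_eq : y = fun s => exp (-(l * s)) • ∫ r in (0:ℝ)..s, exp (l * r) • φ' r := by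
    funext s
    rw [hy, ← intervalIntegral.integral_smul]
    refine intervalIntegral.integral_congr fun r _ => ?_
    simp only [smul_smul, ← Real.exp_add]
    ring_nf
  have hint' : IntervalIntegrable (fun r => exp (l * r) • φ' r) volume 0 t :=
    hint.continuousOn_smul (by fun_prop)
  have hy_cont : ContinuousOn y (Icc 0 t) := by
    rw [hy_eq]
    refine ContinuousOn.smul (by fun_prop) ?_
    have := intervalIntegral.continuousOn_primitive_interval'
      hint' (left_mem_uIcc)
    rwa [uIcc_of_le ht.le] at this
  have hy_deriv : ∀ s ∈ Ioo 0 t, HasDerivAt y (φ' s - l • y s) s := by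
    intro s hs
    have hcs : ContinuousOn (fun r => exp (l * r) • φ' r) (Ioo 0 t) :=
      ContinuousOn.smul (by fun_prop) hc
    have h1 : HasDerivAt (fun s => ∫ r in (0:ℝ)..s, exp (l * r) • φ' r) (exp (l * s) • φ' s) s :=
      intervalIntegral.integral_hasDerivAt_right
        (hint'.mono_set (by
          rw [uIcc_of_le ht.le, uIcc_of_le hs.1.le]; exact Icc_subset_Icc_right hs.2.le))
        (hcs.stronglyMeasurableAtFilter isOpen_Ioo s hs) (hcs.continuousAt (Ioo_mem_nhds hs.1 hs.2))
    have h2 : HasDerivAt (fun s => exp (-(l * s))) (exp (-(l * s)) * (-(l * 1))) s :=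
      (((hasDerivAt_id s).const_mul l).neg).exp
    have h3 := h2.smul h1
    rw [hy_eq]
    refine h3.congr_deriv ?_
    rw [smul_smul, ← Real.exp_add, smul_smul]
    simp only [neg_add_cancel, Real.exp_zero, one_smul, mul_one, mul_neg, neg_smul]
    rw [mul_comm, sub_eq_add_neg]
  have hy0 : y 0 = 0 := by simp [hy]
  have hycI : ContinuousOn y (uIcc 0 t) := by rwa [uIcc_of_le ht.le]
  have hyint : IntervalIntegrable y volume 0 t := hycI.intervalIntegrable
  have hynint : IntervalIntegrable (fun s => ‖y s‖) volume 0 t := hycI.norm.intervalIntegrable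
  have hy2int : IntervalIntegrable (fun s => ‖y s‖ ^ 2) volume 0 t :=
    (hycI.norm.pow 2).intervalIntegrable
  have hinner : IntervalIntegrable (fun s => ⟪y s, φ' s⟫) volume 0 t := by
    obtain ⟨M, hM⟩ := isCompact_Icc.exists_bound_of_continuousOn hy_cont
    rw [intervalIntegrable_iff_integrableOn_Ioc_of_le ht.le] at hint hyint ⊢
    refine Integrable.mono' (hint.norm.const_mul M)
      (hyint.aestronglyMeasurable.inner hint.aestronglyMeasurable) ?_
    filter_upwards [ae_restrict_mem measurableSet_Ioc] with s hs
    exact (norm_inner_le_norm _ _).trans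
      (mul_le_mul_of_nonneg_right (hM s ⟨hs.1.le, hs.2⟩) (norm_nonneg _))
  have hdiff : φ t = y t + l • ∫ s in (0:ℝ)..t, y s := by
    have h := intervalIntegral.integral_eq_sub_of_hasDerivAt_of_le (f := fun s => φ s - y s)
      (f' := fun s => l • y s) ht.le (hcont.sub hy_cont)
      (fun s hs => ((hderiv s hs).sub (hy_deriv s hs)).congr_deriv (by simp)) (hyint.smul l)
    rw [intervalIntegral.integral_smul] at h
    rw [h, hzero, hy0]
    simp
  have henergy : ‖y t‖ ^ 2 = 2 * (∫ s in (0:ℝ)..t, ⟪y s, φ' s⟫)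
      - 2 * l * ∫ s in (0:ℝ)..t, ‖y s‖ ^ 2 := by
    have h := intervalIntegral.integral_eq_sub_of_hasDerivAt_of_le (f := fun s => ‖y s‖ ^ 2)
      (f' := fun s => 2 * ⟪y s, φ' s⟫ - 2 * l * ‖y s‖ ^ 2) ht.le (hy_cont.norm.pow 2)
      (fun s hs => (hy_deriv s hs).norm_sq.congr_deriv <| by
        rw [inner_sub_right, real_inner_smul_right, real_inner_self_eq_norm_sq]
        ring)
      ((hinner.const_mul 2).sub (hy2int.const_mul (2 * l)))
    rw [intervalIntegral.integral_sub (hinner.const_mul 2) (hy2int.const_mul (2 * l)),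
      intervalIntegral.integral_const_mul, intervalIntegral.integral_const_mul, hy0] at h
    simpa using h.symm
  set m := ∫ s in (0:ℝ)..t, ‖y s‖
  set p := ‖φ t‖ / (2 + l * t) with hp
  have hpos : 0 < 2 + l * t := by positivity
  have hp0 : 0 ≤ p := by positivity
  have hD : ‖φ t‖ = p * (2 + l * t) := by rw [hp]; field_simp
  have hnorm : ‖φ t‖ ≤ ‖y t‖ + l * m := by
    conv_lhs => rw [hdiff]
    refine (norm_add_le _ _).trans ?_
    rw [norm_smul, Real.norm_of_nonneg hl.le]
    gcongr
    exact intervalIntegral.norm_integral_le_integral_norm ht.le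
  have hB : 2 * p * m - p ^ 2 * t ≤ ∫ s in (0:ℝ)..t, ‖y s‖ ^ 2 := by
    have h := intervalIntegral.integral_mono_on ht.le
      ((hynint.const_mul (2 * p)).sub (intervalIntegrable_const (c := p ^ 2))) hy2int
      (fun s _ => by nlinarith [sq_nonneg (‖y s‖ - p)])
    rw [intervalIntegral.integral_sub (hynint.const_mul (2 * p)) intervalIntegrable_const,
      intervalIntegral.integral_const_mul, intervalIntegral.integral_const] at h
    simp only [sub_zero, smul_eq_mul] at h
    linarith
  have hgoal : ‖φ t‖ ^ 2 * (1 / (2 + l * t)) = p * ‖φ t‖ := by rw [hp]; ring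
  rw [hgoal]
  have h1 := mul_le_mul_of_nonneg_left hB hl.le
  have h2 := mul_le_mul_of_nonneg_left hnorm hp0
  have h3 : p * ‖φ t‖ = p ^ 2 * (2 + l * t) := by rw [hD]; ring
  nlinarith [sq_nonneg (‖y t‖ - 2 * p)]

/-- The Gram kernel `⟪f r, f s⟫` at `p = (s, r)`, restricted to `0 < r < s ≤ t`. -/
noncomputable def causalGram (f : ℝ → H) (t : ℝ) (p : ℝ × ℝ) : ℝ :=
  (Ioc 0 t).indicator 1 (p.1 - p.2) *
    ⟪(Ioc 0 t).indicator f p.2, (Ioc 0 t).indicator f p.1⟫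

lemma causalGram_of_nonpos {f : ℝ → H} {t : ℝ} {p : ℝ × ℝ} (h : p.1 - p.2 ≤ 0) :
    causalGram f t p = 0 := by
  rw [causalGram, indicator_of_notMem (fun hp => h.not_gt hp.1), zero_mul]

lemma aestronglyMeasurable_causalGram {f : ℝ → H} {t : ℝ}
    (hf : AEStronglyMeasurable f (volume.restrict (Ioc 0 t))) :
    AEStronglyMeasurable (causalGram f t) (volume.prod volume) := by
  have hF : AEStronglyMeasurable ((Ioc 0 t).indicator f) volume :=
    (aestronglyMeasurable_indicator_iff measurableSet_Ioc).2 hf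
  refine AEStronglyMeasurable.mul ?_ (hF.comp_snd.inner hF.comp_fst)
  exact ((measurable_one.indicator measurableSet_Ioc).comp
    (measurable_fst.sub measurable_snd)).aestronglyMeasurable

lemma integral_mul_causalGram [CompleteSpace H] {f : ℝ → H} {g : ℝ → ℝ} {t : ℝ} (ht : 0 < t)
    (hf : IntegrableOn f (Ioc 0 t)) (hg : IntegrableOn g (Ioc 0 t))
    (hint : Integrable (fun p : ℝ × ℝ => g (p.1 - p.2) * causalGram f t p)
      (volume.prod volume)) :
    ∫ p, g (p.1 - p.2) * causalGram f t p ∂(volume.prod volume) =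
      ∫ s in (0:ℝ)..t, ⟪∫ r in (0:ℝ)..s, g (s - r) • f r, f s⟫ := by
  have hF : Integrable ((Ioc 0 t).indicator f) volume := hf.integrable_indicator measurableSet_Ioc
  have hG : Integrable ((Ioc 0 t).indicator g) volume := hg.integrable_indicator measurableSet_Ioc
  rw [integral_prod _ hint, intervalIntegral.integral_of_le ht.le,
    ← integral_indicator measurableSet_Ioc]
  refine integral_congr_ae ?_
  filter_upwards [hF.ae_convolution_exists (ContinuousLinearMap.lsmul ℝ ℝ).flip hG] with s hs
  by_cases hst : s ∈ Ioc 0 t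
  · have hs : Integrable (fun r => (Ioc 0 t).indicator g (s - r) • (Ioc 0 t).indicator f r) := hs
    have hinner : ∫ r in (0:ℝ)..s, g (s - r) • f r =
        ∫ r, (Ioc 0 t).indicator g (s - r) • (Ioc 0 t).indicator f r := by
      rw [intervalIntegral.integral_of_le hst.1.le, integral_Ioc_eq_integral_Ioo,
        ← integral_indicator measurableSet_Ioo]
      congr 1 with r
      by_cases hr : r ∈ Ioo 0 s
      · rw [indicator_of_mem hr, indicator_of_mem, indicator_of_mem]
        · exact ⟨hr.1, hr.2.le.trans hst.2⟩
        · exact ⟨sub_pos.2 hr.2, by linarith [hr.1, hst.2]⟩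
      · rw [indicator_of_notMem hr]
        by_cases h0 : 0 < r
        · rw [indicator_of_notMem, zero_smul]
          exact fun h => hr ⟨h0, sub_pos.1 h.1⟩
        · rw [indicator_of_notMem (s := Ioc 0 t) (a := r), smul_zero]
          exact fun h => h0 h.1
    rw [indicator_of_mem hst, hinner, real_inner_comm, ← integral_inner hs]
    congr 1 with r
    rw [causalGram, indicator_of_mem hst, real_inner_smul_right, real_inner_comm (f s), ← mul_assoc]
    congr 1
    by_cases h : s - r ∈ Ioc 0 t <;> simp [h]
  · simp [causalGram, hst]

lemma integrable_rpow_mul_causalGram {f : ℝ → H} {α μ C t : ℝ} (hα0 : 0 < α)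
    (hμ0 : 0 ≤ μ) (hμ1 : μ < 1 - α)
    (hf : AEStronglyMeasurable f (volume.restrict (Ioc 0 t)))
    (hbound : ∀ s ∈ Ioc (0:ℝ) t, ‖f s‖ ≤ C * s ^ (-μ)) :
    Integrable (fun p : ℝ × ℝ => (p.1 - p.2) ^ (-α) * causalGram f t p)
      (volume.prod volume) := by
  have hpow : ∀ ν : ℝ, ν < 1 → Integrable ((Ioc 0 t).indicator fun x => x ^ (-ν)) volume := by
    intro ν hν
    refine IntegrableOn.integrable_indicator ?_ measurableSet_Ioc
    exact (intervalIntegral.intervalIntegrable_rpow' (by linarith : -1 < -ν)).1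
  have hconv := ((hpow μ (by linarith)).convolution_integrand (ContinuousLinearMap.mul ℝ ℝ)
    (hpow (α + μ) (by linarith))).const_mul (C ^ 2)
  refine hconv.mono' (AEStronglyMeasurable.mul
    (Measurable.aestronglyMeasurable (by fun_prop)) (aestronglyMeasurable_causalGram hf)) ?_
  refine Filter.Eventually.of_forall fun ⟨s, r⟩ => ?_
  simp only [ContinuousLinearMap.mul_apply']
  have hnn : 0 ≤ C ^ 2 * ((Ioc 0 t).indicator (fun x => x ^ (-μ)) r *
      (Ioc 0 t).indicator (fun x => x ^ (-(α + μ))) (s - r)) := by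
    refine mul_nonneg (sq_nonneg C) (mul_nonneg ?_ ?_) <;>
    exact indicator_nonneg (fun x hx => Real.rpow_nonneg hx.1.le _) _
  by_cases hx : s - r ∈ Ioc 0 t
  swap
  · simp [causalGram, hx]
  by_cases hr : r ∈ Ioc 0 t
  swap
  · simp [causalGram, hr]
  by_cases hs : s ∈ Ioc 0 t
  swap
  · simpa [causalGram, hs] using hnn
  have hxpos : 0 < s - r := hx.1
  simp only [causalGram, hx, hr, hs, indicator_of_mem, Pi.one_apply, one_mul, norm_mul]
  rw [Real.norm_of_nonneg (Real.rpow_nonneg hxpos.le _), neg_add, Real.rpow_add hxpos]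
  have h1 : ‖f s‖ ≤ C * (s - r) ^ (-μ) := by
    have hsC := hbound s hs
    have hC : 0 ≤ C := nonneg_of_mul_nonneg_left ((norm_nonneg _).trans hsC)
      (Real.rpow_pos_of_pos hs.1 _)
    exact hsC.trans (mul_le_mul_of_nonneg_left
      (Real.rpow_le_rpow_of_nonpos hxpos (by linarith [hr.1]) (by linarith)) hC)
  calc (s - r) ^ (-α) * ‖⟪f r, f s⟫‖
      ≤ (s - r) ^ (-α) * ((C * r ^ (-μ)) * (C * (s - r) ^ (-μ))) := by
        gcongr
        exact (norm_inner_le_norm _ _).trans (mul_le_mul (hbound r hr) h1 (norm_nonneg _)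
          ((norm_nonneg _).trans (hbound r hr)))
    _ = _ := by ring

lemma integrable_rpow_mul_exp_mul_causalGram {f : ℝ → H} {α t : ℝ} (hα0 : 0 < α)
    (hf : AEStronglyMeasurable f (volume.restrict (Ioc 0 t)))
    (hint : Integrable (fun p : ℝ × ℝ => (p.1 - p.2) ^ (-α) * causalGram f t p)
      (volume.prod volume)) :
    Integrable (Function.uncurry fun (p : ℝ × ℝ) (l : ℝ) =>
      l ^ (α - 1) * exp (-(l * (p.1 - p.2))) * causalGram f t p)
      ((volume.prod volume).prod (volume.restrict (Ioi 0))) := by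
  have hmeas : AEStronglyMeasurable (Function.uncurry fun (p : ℝ × ℝ) (l : ℝ) =>
      l ^ (α - 1) * exp (-(l * (p.1 - p.2))) * causalGram f t p)
      ((volume.prod volume).prod (volume.restrict (Ioi 0))) :=
    AEStronglyMeasurable.mul (Measurable.aestronglyMeasurable (by fun_prop))
      (aestronglyMeasurable_causalGram hf).comp_fst
  refine (integrable_prod_iff hmeas).2 ⟨Filter.Eventually.of_forall fun p => ?_, ?_⟩
  · rcases le_or_gt (p.1 - p.2) 0 with hp | hp
    · simp [causalGram_of_nonpos hp]
    · simp only [Function.uncurry_apply_pair]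
      refine Integrable.mul_const
        (f := fun l : ℝ => l ^ (α - 1) * exp (-(l * (p.1 - p.2)))) ?_ _
      by_contra hn
      have h := Real.integral_rpow_mul_exp_neg_mul_Ioi hα0 hp
      simp_rw [mul_comm (p.1 - p.2)] at h
      rw [integral_undef hn] at h
      have : 0 < Real.Gamma α := Real.Gamma_pos_of_pos hα0
      exact absurd h (by positivity)
  · refine (hint.norm.const_mul (Real.Gamma α)).congr (Filter.Eventually.of_forall fun p => ?_)
    rcases le_or_gt (p.1 - p.2) 0 with hp | hp
    · simp [causalGram_of_nonpos hp]
    · have h := Real.integral_rpow_mul_exp_neg_mul_Ioi hα0 hp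
      have e : ∀ l ∈ Ioi (0:ℝ), ‖l ^ (α - 1) * exp (-(l * (p.1 - p.2))) * causalGram f t p‖ =
          l ^ (α - 1) * exp (-((p.1 - p.2) * l)) * ‖causalGram f t p‖ := by
        intro l hl
        have hl : 0 < l := hl
        rw [norm_mul, Real.norm_of_nonneg (by positivity), mul_comm l]
      simp only [Function.uncurry_apply_pair]
      rw [setIntegral_congr_fun measurableSet_Ioi e, integral_mul_const, h, norm_mul,
        Real.norm_of_nonneg (by positivity), one_div, Real.inv_rpow hp.le, ← Real.rpow_neg hp.le]
      ring

/-- Laplace representation of the quadratic form with kernel `x ^ (-α)` as a superposition of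
quadratic forms with exponential kernels. -/
lemma integral_rpow_mul_integral_exp_mul_causalGram {f : ℝ → H} {α t : ℝ} (hα0 : 0 < α)
    (hf : AEStronglyMeasurable f (volume.restrict (Ioc 0 t)))
    (hint : Integrable (fun p : ℝ × ℝ => (p.1 - p.2) ^ (-α) * causalGram f t p)
      (volume.prod volume)) :
    ∫ l in Ioi (0:ℝ), ∫ p : ℝ × ℝ, l ^ (α - 1) * exp (-(l * (p.1 - p.2))) * causalGram f t p
      ∂(volume.prod volume) =
    Real.Gamma α * ∫ p, (p.1 - p.2) ^ (-α) * causalGram f t p ∂(volume.prod volume) := by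
  rw [← integral_integral_swap (integrable_rpow_mul_exp_mul_causalGram hα0 hf hint),
    ← integral_const_mul]
  congr 1 with p
  rw [integral_mul_const]
  rcases le_or_gt (p.1 - p.2) 0 with hp | hp
  · simp [causalGram_of_nonpos hp]
  · have h := Real.integral_rpow_mul_exp_neg_mul_Ioi hα0 hp
    simp_rw [mul_comm (p.1 - p.2)] at h
    rw [h, one_div, Real.inv_rpow hp.le, ← Real.rpow_neg hp.le]
    ring

end

lemma Gamma_one_add_le_one {α : ℝ} (hα0 : 0 < α) (hα1 : α < 1) : Real.Gamma (1 + α) ≤ 1 := by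
  have h := Real.convexOn_Gamma.2 (show (1:ℝ) ∈ Ioi 0 by simp) (show (2:ℝ) ∈ Ioi 0 by simp)
    (sub_nonneg.2 hα1.le) hα0.le (by ring)
  simp only [smul_eq_mul, Real.Gamma_one, Real.Gamma_two] at h
  rwa [show (1 - α) * 1 + α * 2 = 1 + α by ring, show (1 - α) * 1 + α * 1 = 1 by ring] at h

theorem stmt_1 {H : Type*} [NormedAddCommGroup H] [InnerProductSpace ℝ H] [CompleteSpace H]
    {α T C μ : ℝ} (hα0 : 0 < α) (hα1 : α < 1) (hT : 0 < T)
    (hC : 0 ≤ C) (hμ0 : 0 ≤ μ) (hμ1 : μ < 1 - α)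
    {φ φ' : ℝ → H} (hcont : ContinuousOn φ (Set.Icc 0 T)) (hzero : φ 0 = 0)
    (hderiv : ∀ s ∈ Set.Ioc (0:ℝ) T, HasDerivAt φ (φ' s) s)
    (hderivcont : ContinuousOn φ' (Set.Ioc 0 T))
    (hbound : ∀ s ∈ Set.Ioc (0:ℝ) T, ‖φ' s‖ ≤ C * s ^ (-μ))
    {t : ℝ} (ht : t ∈ Set.Ioc (0:ℝ) T) :
    ‖φ t‖ ^ 2 ≤ 2 * omega (1 + α) t * ∫ s in (0:ℝ)..t, ⟪fracInt (1 - α) φ' s, φ' s⟫ := by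
  obtain ⟨ht0, htT⟩ := ht
  have hα1' : 0 < 1 - α := sub_pos.2 hα1
  have hsub : Ioc 0 t ⊆ Ioc 0 T := Ioc_subset_Ioc_right htT
  have hmeas : AEStronglyMeasurable φ' (volume.restrict (Ioc 0 t)) :=
    (hderivcont.mono hsub).aestronglyMeasurable measurableSet_Ioc
  have hbound' : ∀ s ∈ Ioc (0:ℝ) t, ‖φ' s‖ ≤ C * s ^ (-μ) := fun s hs => hbound s (hsub hs)
  have hint : IntegrableOn φ' (Ioc 0 t) := by
    have hpow : IntegrableOn (fun x : ℝ => x ^ (-μ)) (Ioc 0 t) :=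
      (intervalIntegral.intervalIntegrable_rpow' (by linarith : -1 < -μ)).1
    refine Integrable.mono' (hpow.const_mul C) hmeas ?_
    filter_upwards [ae_restrict_mem measurableSet_Ioc] with s hs using hbound' s hs
  have hkernel := integrable_rpow_mul_causalGram hα0 hμ0 hμ1 hmeas hbound'
  have htriple := integrable_rpow_mul_exp_mul_causalGram hα0 hmeas hkernel
  have hrepr := integral_rpow_mul_integral_exp_mul_causalGram hα0 hmeas hkernel
  have hlower : ∫ l in Ioi (0:ℝ), ‖φ t‖ ^ 2 * (l ^ (α - 1) * (1 / (2 + l * t))) ≤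
      ∫ l in Ioi (0:ℝ), ∫ p : ℝ × ℝ, l ^ (α - 1) * exp (-(l * (p.1 - p.2))) * causalGram φ' t p
        ∂(volume.prod volume) := by
    refine integral_mono_of_nonneg ?_ htriple.integral_prod_right ?_
    · filter_upwards [ae_restrict_mem measurableSet_Ioi] with l hl
      have hl : 0 < l := hl
      simp only [Pi.zero_apply]
      positivity
    · filter_upwards [ae_restrict_mem measurableSet_Ioi, htriple.prod_left_ae] with l hl hlint
      have hl : 0 < l := hl
      have hlpow : 0 < l ^ (α - 1) := Real.rpow_pos_of_pos hl _
      simp only [Function.uncurry_apply_pair, mul_assoc] at hlint ⊢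
      have hexp := (integrable_const_mul_iff hlpow.ne'.isUnit _).1 hlint
      rw [integral_const_mul, mul_left_comm]
      refine mul_le_mul_of_nonneg_left ?_ hlpow.le
      rw [integral_mul_causalGram (g := fun x => exp (-(l * x))) ht0 hint
        (Continuous.integrableOn_Ioc (by fun_prop)) hexp]
      exact norm_sq_div_le_integral_exp_kernel ht0 hl (hcont.mono (Icc_subset_Icc_right htT)) hzero
        (fun s hs => hderiv s (hsub (Ioo_subset_Ioc_self hs)))
        (hderivcont.mono (Ioo_subset_Ioc_self.trans hsub))
        ((intervalIntegrable_iff_integrableOn_Ioc_of_le ht0.le).2 hint)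
  have hform : ∫ p, (p.1 - p.2) ^ (-α) * causalGram φ' t p ∂(volume.prod volume) =
      Real.Gamma (1 - α) * ∫ s in (0:ℝ)..t, ⟪fracInt (1 - α) φ' s, φ' s⟫ := by
    rw [integral_mul_causalGram (g := fun x => x ^ (-α)) ht0 hint
      (intervalIntegral.intervalIntegrable_rpow' (by linarith : -1 < -α)).1 hkernel,
      ← intervalIntegral.integral_const_mul]
    refine intervalIntegral.integral_congr fun s _ => ?_
    have hΓ : Real.Gamma (1 - α) ≠ 0 := (Real.Gamma_pos_of_pos hα1').ne'
    simp only [fracInt]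
    rw [← real_inner_smul_left, ← intervalIntegral.integral_smul]
    congr 2 with r
    rw [smul_smul, omega, mul_div_cancel₀ _ hΓ]
    ring_nf
  rw [integral_const_mul, integral_rpow_div_add_mul hα0 hα1 two_pos ht0, hrepr, hform] at hlower
  set Q := ∫ s in (0:ℝ)..t, ⟪fracInt (1 - α) φ' s, φ' s⟫
  have hΓα : 0 < Real.Gamma α := Real.Gamma_pos_of_pos hα0
  have hΓα' : 0 < Real.Gamma (1 - α) := Real.Gamma_pos_of_pos hα1'
  have hΓ1 : 0 < Real.Gamma (1 + α) := Real.Gamma_pos_of_pos (by linarith)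
  have hcoer : ‖φ t‖ ^ 2 * (2 ^ (α - 1) * t ^ (-α)) ≤ Q :=
    le_of_mul_le_mul_left (by linarith) (mul_pos hΓα hΓα')
  have htwo : (1:ℝ) / 2 ≤ 2 ^ (α - 1) := by
    have := Real.rpow_le_rpow_of_exponent_le one_le_two (show (-1:ℝ) ≤ α - 1 by linarith)
    rwa [Real.rpow_neg_one, ← one_div] at this
  have htα : t ^ (-α) * t ^ α = 1 := by
    rw [← Real.rpow_add ht0, neg_add_cancel, Real.rpow_zero]
  have htα0 : 0 < t ^ α := Real.rpow_pos_of_pos ht0 _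
  have hstrong : ‖φ t‖ ^ 2 ≤ 2 * t ^ α * Q := by
    calc ‖φ t‖ ^ 2 = 2 * t ^ α * (‖φ t‖ ^ 2 * (1 / 2 * t ^ (-α))) := by
          linear_combination -‖φ t‖ ^ 2 * htα
      _ ≤ 2 * t ^ α * (‖φ t‖ ^ 2 * (2 ^ (α - 1) * t ^ (-α))) := by gcongr
      _ ≤ 2 * t ^ α * Q := by gcongr
  rw [omega, add_sub_cancel_left, mul_div_assoc', div_mul_eq_mul_div, le_div_iff₀ hΓ1]
  exact (mul_le_of_le_one_right (sq_nonneg _) (Gamma_one_add_le_one hα0 hα1)).trans hstrong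
end

section
/- Let H be a real Hilbert space, let 0 < α < 1 and T > 0, and let φ : [0,T] → H be continuous. Then for every t ∈ [0,T], ∫_0^t ⟨(I^{1-α}φ)(s), φ(s)⟩ ds ≥ 0; equivalently, the iterated integral ∫_0^t ∫_0^s ω_{1-α}(s-q) ⟨φ(q), φ(s)⟩ dq ds is nonnegative. -/
open MeasureTheory Real Set RealInnerProductSpace

lemma intervalIntegral_inner {H : Type*} [NormedAddCommGroup H] [InnerProductSpace ℝ H]
    [CompleteSpace H] {f : ℝ → H} {a b : ℝ} (hf : IntervalIntegrable f volume a b) (c : H) :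
    ∫ x in a..b, ⟪c, f x⟫ = ⟪c, ∫ x in a..b, f x⟫ :=
  (innerSL ℝ c).intervalIntegral_comp_comm hf

/-- The kernel `exp (-x * (s - q))` is of positive type. -/
lemma integral_exp_kernel_nonneg {H : Type*} [NormedAddCommGroup H] [InnerProductSpace ℝ H]
    [CompleteSpace H] {ψ : ℝ → H} (hψ : Continuous ψ) {t x : ℝ} (ht : 0 ≤ t) (hx : 0 < x) :
    0 ≤ ∫ s in (0:ℝ)..t, ∫ q in (0:ℝ)..s, exp (-(s - q) * x) * ⟪ψ q, ψ s⟫ := by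
  set z : ℝ → H := fun s => ∫ q in (0:ℝ)..s, exp (q * x) • ψ q with hz
  have hcont : Continuous fun q => exp (q * x) • ψ q := by fun_prop
  have hzd : ∀ s, HasDerivAt z (exp (s * x) • ψ s) s := fun s =>
    intervalIntegral.integral_hasDerivAt_right (hcont.intervalIntegrable _ _)
      hcont.aestronglyMeasurable.stronglyMeasurableAtFilter hcont.continuousAt
  have hzc : Continuous z := continuous_iff_continuousAt.2 fun s => (hzd s).continuousAt
  have hinner : ∀ s, (∫ q in (0:ℝ)..s, exp (-(s - q) * x) * ⟪ψ q, ψ s⟫)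
      = exp (-(s * x)) * ⟪z s, ψ s⟫ := by
    intro s
    rw [real_inner_comm, hz, ← intervalIntegral_inner
      (hcont.intervalIntegrable _ _), ← intervalIntegral.integral_const_mul]
    refine intervalIntegral.integral_congr fun q _ => ?_
    simp only [inner_smul_right, real_inner_comm (ψ s) (ψ q)]
    rw [← mul_assoc, ← exp_add]
    congr 2
    ring
  have hE : ∀ s, HasDerivAt (fun s => exp (-(s * (2 * x))) * (⟪z s, z s⟫ / 2))
      (exp (-(s * x)) * ⟪z s, ψ s⟫ - x * (exp (-(s * (2 * x))) * ⟪z s, z s⟫)) s := by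
    intro s
    have h1 : HasDerivAt (fun s : ℝ => exp (-(s * (2 * x))))
        (exp (-(s * (2 * x))) * (-(1 * (2 * x)))) s :=
      (((hasDerivAt_id s).mul_const (2 * x)).neg).exp
    have h2 := ((hzd s).inner ℝ (hzd s)).div_const 2
    refine (h1.mul h2).congr_deriv ?_
    have h3 : exp (-(s * x)) = exp (-(s * (2 * x))) * exp (s * x) := by
      rw [← exp_add]; congr 1; ring
    rw [real_inner_smul_right, real_inner_smul_left, real_inner_comm (z s) (ψ s), h3]
    ring
  have hc1 : Continuous fun s => exp (-(s * x)) * ⟪z s, ψ s⟫ := by fun_prop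
  have hc2 : Continuous fun s => x * (exp (-(s * (2 * x))) * ⟪z s, z s⟫) := by fun_prop
  have hFTC := intervalIntegral.integral_eq_sub_of_hasDerivAt (a := 0) (b := t)
    (fun s _ => hE s) ((hc1.sub hc2).intervalIntegrable _ _)
  rw [intervalIntegral.integral_sub (hc1.intervalIntegrable _ _)
    (hc2.intervalIntegrable _ _)] at hFTC
  have h0 : z 0 = 0 := by simp [hz]
  have hpos : 0 ≤ ∫ s in (0:ℝ)..t, x * (exp (-(s * (2 * x))) * ⟪z s, z s⟫) :=
    intervalIntegral.integral_nonneg ht fun s _ =>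
      mul_nonneg hx.le (mul_nonneg (exp_pos _).le real_inner_self_nonneg)
  have hEt : 0 ≤ exp (-(t * (2 * x))) * (⟪z t, z t⟫ / 2) :=
    mul_nonneg (exp_pos _).le (div_nonneg real_inner_self_nonneg zero_le_two)
  simp only [hinner]
  simp only [h0, inner_zero_left, zero_div, mul_zero, sub_zero] at hFTC
  linarith

lemma intervalIntegral_eq_setIntegral_indicator {t s : ℝ} (hs : s ∈ Ioc 0 t) (f : ℝ → ℝ) :
    ∫ q in (0:ℝ)..s, f q = ∫ q in Ioc 0 t, (Iio s).indicator f q := by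
  rw [setIntegral_indicator measurableSet_Iio, intervalIntegral.integral_of_le hs.1.le,
    integral_Ioc_eq_integral_Ioo]
  congr 2
  ext q
  simp only [mem_Ioo, mem_inter_iff, mem_Ioc, mem_Iio]
  exact ⟨fun h => ⟨⟨h.1, h.2.le.trans hs.2⟩, h.2⟩, fun h => ⟨h.1.1, h.2⟩⟩

lemma integrable_rpow_sub_indicator {a : ℝ} (ha1 : a < 1) (t : ℝ) :
    Integrable (fun p : ℝ × ℝ => (Iio p.1).indicator (fun q => (p.1 - q) ^ (-a)) p.2)
      ((volume.restrict (Ioc 0 t)).prod (volume.restrict (Ioc 0 t))) := by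
  have hf : Integrable ((Ioc 0 t).indicator fun _ => (1:ℝ)) :=
    (integrable_indicator_iff measurableSet_Ioc).2 (by simp)
  have hg : Integrable ((Ioc 0 t).indicator fun u : ℝ => u ^ (-a)) := by
    rw [integrable_indicator_iff measurableSet_Ioc]
    rcases le_total 0 t with h | h
    · exact (intervalIntegrable_iff_integrableOn_Ioc_of_le h).1
        (intervalIntegral.intervalIntegrable_rpow' (by linarith))
    · simp [Ioc_eq_empty (not_lt.2 h)]
  have h := hf.convolution_integrand (ContinuousLinearMap.mul ℝ ℝ) hg
  rw [Measure.prod_restrict]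
  refine (h.integrableOn (s := Ioc 0 t ×ˢ Ioc 0 t)).congr ?_
  filter_upwards [ae_restrict_mem (measurableSet_Ioc.prod measurableSet_Ioc)] with p hp
  obtain ⟨hp1, hp2⟩ := hp
  by_cases hlt : p.2 < p.1
  · have : p.1 - p.2 ∈ Ioc 0 t := ⟨by linarith, by linarith [hp1.2, hp2.1]⟩
    simp [hp2, hlt, this]
  · have : p.1 - p.2 ∉ Ioc 0 t := fun h => hlt (by linarith [h.1])
    simp [hlt, this]

lemma integral_rpow_kernel_nonneg {H : Type*} [NormedAddCommGroup H] [InnerProductSpace ℝ H]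
    [CompleteSpace H] {ψ : ℝ → H} (hψ : Continuous ψ) {M : ℝ} (hM : ∀ s, ‖ψ s‖ ≤ M)
    {t a : ℝ} (ht : 0 ≤ t) (ha0 : 0 < a) (ha1 : a < 1) :
    0 ≤ ∫ s in (0:ℝ)..t, ∫ q in (0:ℝ)..s, (s - q) ^ (-a) * ⟪ψ q, ψ s⟫ := by
  set μ := volume.restrict (Ioc 0 t) with hμ
  set ν := volume.restrict (Ioi (0:ℝ)) with hν
  have hM0 : 0 ≤ M := (norm_nonneg _).trans (hM 0)
  have hin : Continuous fun p : ℝ × ℝ => ⟪ψ p.2, ψ p.1⟫ := by fun_prop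
  have hinb : ∀ p : ℝ × ℝ, ‖⟪ψ p.2, ψ p.1⟫‖ ≤ M * M := fun p =>
    (norm_inner_le_norm _ _).trans (mul_le_mul (hM _) (hM _) (norm_nonneg _) hM0)
  have hΓ : 0 < Gamma a := Gamma_pos_of_pos ha0
  set F : ℝ × ℝ × ℝ → ℝ := fun p => (Iio p.2.1).indicator
    (fun q => p.1 ^ (a - 1) * exp (-((p.2.1 - q) * p.1)) * ⟪ψ q, ψ p.2.1⟫) p.2.2 with hF
  have hpow : ∀ r : ℝ, 0 < r →
      ∫ x, x ^ (a - 1) * exp (-(r * x)) ∂ν = Gamma a * r ^ (-a) := by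
    intro r hr
    rw [hν, integral_rpow_mul_exp_neg_mul_Ioi ha0 hr, one_div, inv_rpow hr.le, rpow_neg hr.le,
      mul_comm]
  have hpowi : ∀ r : ℝ, 0 < r → Integrable (fun x => x ^ (a - 1) * exp (-(r * x))) ν := by
    intro r hr
    refine Integrable.of_integral_ne_zero ?_
    rw [hpow r hr]
    positivity
  have hFx : ∀ y : ℝ × ℝ, Integrable (fun x => F (x, y)) ν := by
    intro y
    by_cases h : y.2 < y.1
    · simpa [hF, h] using (hpowi (y.1 - y.2) (sub_pos.2 h)).mul_const ⟪ψ y.2, ψ y.1⟫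
    · simp [hF, h]
  have hFint : ∀ y : ℝ × ℝ, ∫ x, F (x, y) ∂ν = Gamma a *
      (Iio y.1).indicator (fun q => (y.1 - q) ^ (-a) * ⟪ψ q, ψ y.1⟫) y.2 := by
    intro y
    by_cases h : y.2 < y.1
    · simp only [hF, indicator_of_mem (mem_Iio.2 h)]
      rw [integral_mul_const, hpow _ (sub_pos.2 h), mul_assoc]
    · simp [hF, h]
  have hFnorm : ∀ y : ℝ × ℝ, ∫ x, ‖F (x, y)‖ ∂ν = Gamma a *
      ((Iio y.1).indicator (fun q => (y.1 - q) ^ (-a)) y.2 * ‖⟪ψ y.2, ψ y.1⟫‖) := by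
    intro y
    by_cases h : y.2 < y.1
    · have : ∀ᵐ x ∂ν, ‖F (x, y)‖ =
          x ^ (a - 1) * exp (-((y.1 - y.2) * x)) * ‖⟪ψ y.2, ψ y.1⟫‖ := by
        filter_upwards [ae_restrict_mem measurableSet_Ioi] with x hx
        have hx : 0 < x := hx
        have h0 : 0 ≤ x ^ (a - 1) * exp (-((y.1 - y.2) * x)) := by positivity
        simp only [hF, indicator_of_mem (mem_Iio.2 h)]
        rw [norm_mul, Real.norm_of_nonneg h0]
      rw [integral_congr_ae this, integral_mul_const, hpow _ (sub_pos.2 h),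
        indicator_of_mem (mem_Iio.2 h), mul_assoc]
    · simp [hF, h]
  have hFm : Measurable F := by
    have hs : MeasurableSet {p : ℝ × ℝ × ℝ | p.2.2 < p.2.1} :=
      measurableSet_lt (by fun_prop) (by fun_prop)
    have hm : Measurable fun p : ℝ × ℝ × ℝ =>
        p.1 ^ (a - 1) * exp (-((p.2.1 - p.2.2) * p.1)) * ⟪ψ p.2.2, ψ p.2.1⟫ :=
      (by fun_prop : Measurable fun p : ℝ × ℝ × ℝ =>
        p.1 ^ (a - 1) * exp (-((p.2.1 - p.2.2) * p.1))).mul (hin.measurable.comp measurable_snd)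
    exact hm.indicator hs
  have hprod : ∀ {f : ℝ × ℝ → ℝ}, Continuous f → (∀ p, ‖f p‖ ≤ M * M) → Integrable
      (fun y : ℝ × ℝ => (Iio y.1).indicator (fun q => (y.1 - q) ^ (-a)) y.2 * f y)
      (μ.prod μ) := fun hf hb =>
    (integrable_rpow_sub_indicator ha1 t).mul_bdd (c := M * M) hf.aestronglyMeasurable
      (Filter.Eventually.of_forall hb)
  have hFi : Integrable F (ν.prod (μ.prod μ)) := by
    rw [integrable_prod_iff' hFm.aestronglyMeasurable]
    refine ⟨Filter.Eventually.of_forall hFx, ?_⟩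
    simp only [hFnorm]
    exact (hprod hin.norm fun p => by simpa using hinb p).const_mul _
  have hsymm := (integral_prod F hFi).symm.trans (integral_prod_symm F hFi)
  have hleft : 0 ≤ ∫ x, ∫ y, F (x, y) ∂(μ.prod μ) ∂ν := by
    refine integral_nonneg_of_ae ?_
    filter_upwards [hFi.prod_right_ae, ae_restrict_mem measurableSet_Ioi] with x hxi hx
    have hx : 0 < x := hx
    have key := integral_exp_kernel_nonneg hψ ht hx
    rw [integral_prod _ hxi]
    have heq : ∫ s, ∫ q, F (x, s, q) ∂μ ∂μ = x ^ (a - 1) *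
        ∫ s in (0:ℝ)..t, ∫ q in (0:ℝ)..s, exp (-(s - q) * x) * ⟪ψ q, ψ s⟫ := by
      rw [intervalIntegral.integral_of_le ht, ← integral_const_mul]
      refine setIntegral_congr_fun measurableSet_Ioc fun s hs => ?_
      rw [← intervalIntegral.integral_const_mul, intervalIntegral_eq_setIntegral_indicator hs]
      simp only [hF, neg_mul, mul_assoc, hμ]
    rw [heq]
    positivity
  have hright : ∫ y, ∫ x, F (x, y) ∂ν ∂(μ.prod μ) = Gamma a *
      ∫ s in (0:ℝ)..t, ∫ q in (0:ℝ)..s, (s - q) ^ (-a) * ⟪ψ q, ψ s⟫ := by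
    simp only [hFint]
    rw [integral_const_mul, integral_prod, intervalIntegral.integral_of_le ht]
    · congr 1
      refine setIntegral_congr_fun measurableSet_Ioc fun s hs => ?_
      exact (intervalIntegral_eq_setIntegral_indicator hs _).symm
    · refine (hprod hin hinb).congr (Filter.Eventually.of_forall fun y => ?_)
      by_cases h : y.2 < y.1 <;> simp [h]
  rw [hsymm, hright] at hleft
  exact nonneg_of_mul_nonneg_right hleft hΓ

theorem stmt_2 {H : Type*} [NormedAddCommGroup H] [InnerProductSpace ℝ H] [CompleteSpace H]
    {α T : ℝ} (hα0 : 0 < α) (hα1 : α < 1) (hT : 0 < T)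
    {φ : ℝ → H} (hφ : ContinuousOn φ (Set.Icc 0 T))
    {t : ℝ} (ht : t ∈ Set.Icc (0:ℝ) T) :
    0 ≤ (∫ s in (0:ℝ)..t, ⟪fracInt (1 - α) φ s, φ s⟫) ∧
      0 ≤ ∫ s in (0:ℝ)..t, ∫ q in (0:ℝ)..s, omega (1 - α) (s - q) * ⟪φ q, φ s⟫ := by
  have hΓ : 0 < Gamma (1 - α) := Gamma_pos_of_pos (by linarith)
  obtain ⟨M, hM⟩ := isCompact_Icc.exists_bound_of_continuousOn hφ
  set ψ : ℝ → H := IccExtend hT.le ((Icc 0 T).domRestrict φ) with hψdef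
  have hψ : Continuous ψ := hφ.domRestrict.Icc_extend'
  have hψM : ∀ s, ‖ψ s‖ ≤ M := fun s => hM _ (projIcc 0 T hT.le s).2
  have hψφ : ∀ s ∈ Icc 0 T, ψ s = φ s := fun s hs => by
    rw [hψdef, IccExtend_of_mem _ _ hs, domRestrict_apply]
  have hωi : ∀ s, 0 ≤ s → IntervalIntegrable (fun q => omega (1 - α) (s - q)) volume 0 s := by
    intro s hs
    have h := (intervalIntegral.intervalIntegrable_rpow' (a := s) (b := 0) (r := 1 - α - 1)
      (by linarith)).comp_sub_left s
    simpa [omega] using h.div_const (Gamma (1 - α))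
  have hsub : ∀ s ∈ Icc 0 t, ∀ q ∈ Icc 0 s, ψ q = φ q := fun s hs q hq =>
    hψφ q ⟨hq.1, hq.2.trans (hs.2.trans ht.2)⟩
  have hsecond : 0 ≤ ∫ s in (0:ℝ)..t, ∫ q in (0:ℝ)..s, omega (1 - α) (s - q) * ⟪φ q, φ s⟫ := by
    have key := integral_rpow_kernel_nonneg hψ hψM ht.1 hα0 hα1
    have heq : ∫ s in (0:ℝ)..t, ∫ q in (0:ℝ)..s, omega (1 - α) (s - q) * ⟪φ q, φ s⟫ =
        (Gamma (1 - α))⁻¹ *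
          ∫ s in (0:ℝ)..t, ∫ q in (0:ℝ)..s, (s - q) ^ (-α) * ⟪ψ q, ψ s⟫ := by
      rw [← intervalIntegral.integral_const_mul]
      refine intervalIntegral.integral_congr fun s hs => ?_
      rw [uIcc_of_le ht.1] at hs
      rw [← intervalIntegral.integral_const_mul]
      refine intervalIntegral.integral_congr fun q hq => ?_
      rw [uIcc_of_le hs.1] at hq
      simp only [hsub s hs q hq, hsub s hs s ⟨hs.1, le_rfl⟩, omega, sub_sub_cancel_left]
      ring
    rw [heq]
    positivity
  refine ⟨?_, hsecond⟩
  convert hsecond using 1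
  refine intervalIntegral.integral_congr fun s hs => ?_
  rw [uIcc_of_le ht.1] at hs
  have hi : IntervalIntegrable (fun q => omega (1 - α) (s - q) • φ q) volume 0 s := by
    refine (hωi s hs.1).smul_continuousOn ?_
    rw [uIcc_of_le hs.1]
    exact hφ.mono (Icc_subset_Icc_right (hs.2.trans ht.2))
  simp only [fracInt]
  rw [real_inner_comm, ← intervalIntegral_inner hi]
  refine intervalIntegral.integral_congr fun q _ => ?_
  simp only [inner_smul_right, real_inner_comm (φ s) (φ q)]
end

section
/- Let H be a real Hilbert space, let 0 < α < 1 and T > 0, and let w : [0,T] → H be continuously differentiable with w(0) = 0. Then for every t ∈ [0,T], ∫_0^t ⟨(I^{1-α}w')(s), w(s)⟩ ds ≥ 0, where w' denotes the derivative of w. -/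
open MeasureTheory Real Set RealInnerProductSpace

lemma hasDerivAt_omega_add_one {μ x : ℝ} (hμ : 0 < μ) (hx : 0 < x) :
    HasDerivAt (omega (μ + 1)) (omega μ x) x := by
  unfold omega
  have h := (Real.hasDerivAt_rpow_const (p := μ + 1 - 1) (Or.inl hx.ne')).div_const
    (Real.Gamma (μ + 1))
  refine h.congr_deriv ?_
  have hΓ := (Real.Gamma_pos_of_pos hμ).ne'
  rw [Real.Gamma_add_one hμ.ne']
  simp only [add_sub_cancel_right]
  field_simp

lemma exists_hasDerivAt_omega_nonpos {μ x : ℝ} (hμ : 0 < μ) (hμ1 : μ ≤ 1) (hx : 0 < x) :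
    ∃ d ≤ 0, HasDerivAt (omega μ) d x := by
  refine ⟨(μ - 1) * x ^ (μ - 1 - 1) / Real.Gamma μ, ?_, ?_⟩
  · exact div_nonpos_of_nonpos_of_nonneg
      (mul_nonpos_of_nonpos_of_nonneg (by linarith) (Real.rpow_nonneg hx.le _))
      (Real.Gamma_pos_of_pos hμ).le
  · exact (Real.hasDerivAt_rpow_const (Or.inl hx.ne')).div_const _

lemma omega_nonneg {μ x : ℝ} (hμ : 0 < μ) (hx : 0 ≤ x) : 0 ≤ omega μ x :=
  div_nonneg (Real.rpow_nonneg hx _) (Real.Gamma_pos_of_pos hμ).le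

lemma continuous_omega_add_one {μ : ℝ} (hμ : 0 ≤ μ) : Continuous (omega (μ + 1)) := by
  unfold omega
  exact (Real.continuous_rpow_const (by linarith)).div_const _

lemma omega_add_one_zero {μ : ℝ} (hμ : μ ≠ 0) : omega (μ + 1) 0 = 0 := by
  simp [omega, Real.zero_rpow hμ]

lemma intervalIntegrable_omega {μ : ℝ} (hμ : 0 < μ) (a b : ℝ) :
    IntervalIntegrable (omega μ) volume a b :=
  (intervalIntegral.intervalIntegrable_rpow' (by linarith)).div_const _

lemma intervalIntegrable_omega_sub {μ : ℝ} (hμ : 0 < μ) (s a b : ℝ) :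
    IntervalIntegrable (fun r => omega μ (s - r)) volume a b := by
  have h := (intervalIntegrable_omega hμ (s - a) (s - b)).comp_sub_left s
  simpa using h

lemma integral_omega {μ : ℝ} (hμ : 0 < μ) (x : ℝ) :
    ∫ s in (0:ℝ)..x, omega μ s = omega (μ + 1) x := by
  unfold omega
  rw [intervalIntegral.integral_div, integral_rpow (Or.inl (by linarith)),
    Real.Gamma_add_one hμ.ne']
  simp only [sub_add_cancel, add_sub_cancel_right, Real.zero_rpow hμ.ne', sub_zero]
  rw [div_div]

/-- The integral of `I^μ φ` is `I^{μ+1} φ`. -/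
lemma integral_fracInt {μ : ℝ} (hμ : 0 < μ) {t : ℝ} (ht : 0 ≤ t) {φ : ℝ → ℝ}
    (hφ : IntervalIntegrable φ volume 0 t) :
    IntervalIntegrable (fracInt μ φ) volume 0 t ∧
      ∫ s in (0:ℝ)..t, fracInt μ φ s = fracInt (μ + 1) φ t := by
  have hφ' : Integrable ((Ioc 0 t).indicator φ) volume :=
    (integrable_indicator_iff measurableSet_Ioc).2
      ((intervalIntegrable_iff_integrableOn_Ioc_of_le ht).1 hφ)
  have hk : Integrable ((Ioc 0 t).indicator (omega μ)) volume :=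
    (integrable_indicator_iff measurableSet_Ioc).2
      ((intervalIntegrable_iff_integrableOn_Ioc_of_le ht).1 (intervalIntegrable_omega hμ 0 t))
  set h : ℝ → ℝ → ℝ := fun s r =>
    (Ioc 0 t).indicator φ r * (Ioc 0 t).indicator (omega μ) (s - r) with h_def
  have hint : Integrable (Function.uncurry h) ((volume.restrict (Ioc 0 t)).prod volume) := by
    have h1 : Integrable (Function.uncurry h) (volume.prod volume) :=
      hφ'.convolution_integrand (ContinuousLinearMap.mul ℝ ℝ) hk
    have h2 := h1.restrict (s := Ioc 0 t ×ˢ univ)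
    rwa [← Measure.prod_restrict, Measure.restrict_univ] at h2
  have hinner : ∀ s ∈ Ioc 0 t, ∫ r, h s r = fracInt μ φ s := by
    intro s hs
    have : h s = (Ioo 0 s).indicator (fun r => omega μ (s - r) • φ r) := by
      funext r
      simp only [h_def, Set.indicator_apply, mem_Ioc, mem_Ioo, smul_eq_mul] at hs ⊢
      split_ifs <;> first | ring1 | (exfalso; grind)
    rw [this, integral_indicator measurableSet_Ioo, fracInt,
      intervalIntegral.integral_of_le hs.1.le, integral_Ioc_eq_integral_Ioo]
  have houter : ∀ r, ∫ s in Ioc 0 t, h s r =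
      (Ioc 0 t).indicator (fun r => omega (μ + 1) (t - r) • φ r) r := by
    intro r
    by_cases hr : r ∈ Ioc 0 t
    · have : ∀ s ∈ Ioc 0 t, h s r =
          (Ioc r t).indicator (fun s => φ r * omega μ (s - r)) s := by
        intro s hs
        simp only [h_def, Set.indicator_apply, mem_Ioc] at hs hr ⊢
        split_ifs <;> first | ring1 | (exfalso; grind)
      rw [setIntegral_congr_fun measurableSet_Ioc this, setIntegral_indicator measurableSet_Ioc,
        inter_eq_self_of_subset_right (Ioc_subset_Ioc_left hr.1.le),
        ← intervalIntegral.integral_of_le hr.2, intervalIntegral.integral_const_mul,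
        intervalIntegral.integral_comp_sub_right (fun x => omega μ x), sub_self,
        integral_omega hμ, indicator_of_mem hr, smul_eq_mul, mul_comm]
    · simp [h_def, indicator_of_notMem hr]
  constructor
  · rw [intervalIntegrable_iff_integrableOn_Ioc_of_le ht]
    refine IntegrableOn.congr_fun (f := fun s => ∫ r, h s r) ?_ hinner measurableSet_Ioc
    exact hint.integral_prod_left
  · rw [intervalIntegral.integral_of_le ht,
      ← setIntegral_congr_fun measurableSet_Ioc hinner, integral_integral_swap hint]
    simp_rw [houter]
    rw [integral_indicator measurableSet_Ioc, fracInt, intervalIntegral.integral_of_le ht]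

lemma fracInt_deriv_nonpos {μ s : ℝ} (hμ : 0 < μ) (hμ1 : μ ≤ 1) (hs : 0 ≤ s) {f f' : ℝ → ℝ}
    (hf : ∀ r ∈ Icc 0 s, HasDerivAt f (f' r) r) (hf' : ContinuousOn f' (Icc 0 s))
    (hf0 : ∀ r ∈ Icc 0 s, 0 ≤ f r) (hfs : f s = 0) : fracInt μ f' s ≤ 0 := by
  have hd : ContinuousOn (dslope f s) (Icc 0 s) := by
    intro r hr
    refine ContinuousAt.continuousWithinAt ?_
    rcases eq_or_ne r s with rfl | hne
    · exact continuousAt_dslope_same.2 (hf r hr).differentiableAt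
    · exact (continuousAt_dslope_of_ne hne).2 (hf r hr).continuousAt
  have hcont : ContinuousOn (fun r => omega μ (s - r) * f r) (Icc 0 s) := by
    have h1 : ContinuousOn (fun r => -((s - r) ^ μ / Real.Gamma μ) * dslope f s r) (Icc 0 s) := by
      refine ContinuousOn.mul ?_ hd
      have : Continuous fun r : ℝ => (s - r) ^ μ :=
        (Real.continuous_rpow_const hμ.le).comp (continuous_const.sub continuous_id)
      exact (this.div_const _).neg.continuousOn
    refine h1.congr fun r hr => ?_
    rcases eq_or_lt_of_le hr.2 with rfl | hlt
    · simp [hfs, Real.zero_rpow hμ.ne']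
    · have hpos : 0 < s - r := sub_pos.2 hlt
      have hsl : f r = (r - s) * dslope f s r := by
        have := sub_smul_dslope f s r
        rw [smul_eq_mul, hfs, sub_zero] at this
        exact this.symm
      have hpow : (s - r) ^ μ = (s - r) ^ (μ - 1) * (s - r) := by
        rw [← Real.rpow_add_one hpos.ne', sub_add_cancel]
      simp only [omega]
      rw [hpow, hsl]
      ring
  choose! d hd0 hd' using
    fun x (hx : 0 < x) => exists_hasDerivAt_omega_nonpos hμ hμ1 hx
  have hint : IntegrableOn (fun r => omega μ (s - r) • f' r) (Icc 0 s) := by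
    rw [integrableOn_Icc_iff_integrableOn_Ioc, ← intervalIntegrable_iff_integrableOn_Ioc_of_le hs]
    exact (intervalIntegrable_omega_sub hμ s 0 s).smul_continuousOn (by rwa [uIcc_of_le hs])
  have key := intervalIntegral.integral_le_sub_of_hasDeriv_right_of_le
    (g' := fun r => -d (s - r) * f r + omega μ (s - r) * f' r) hs hcont
    (fun r hr => by
      have h1 := (hd' (s - r) (sub_pos.2 hr.2)).comp r ((hasDerivAt_id r).const_sub s)
      have h2 := h1.fun_mul (hf r (Ioo_subset_Icc_self hr))
      exact HasDerivAt.hasDerivWithinAt (by simpa [Function.comp_def] using h2))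
    hint
    (fun r hr => by
      have h1 := mul_nonneg (neg_nonneg.2 (hd0 (s - r) (sub_pos.2 hr.2)))
        (hf0 r (Ioo_subset_Icc_self hr))
      simp only [smul_eq_mul]
      linarith)
  have h0 := mul_nonneg (omega_nonneg hμ (sub_nonneg.2 hs)) (hf0 0 (left_mem_Icc.2 hs))
  simp only [hfs, mul_zero] at key
  unfold fracInt
  linarith

lemma fracInt_add_one_deriv_nonneg {μ t : ℝ} (hμ : 0 < μ) (ht : 0 ≤ t) {g g' : ℝ → ℝ}
    (hg : ∀ r ∈ Icc 0 t, HasDerivAt g (g' r) r) (hg' : ContinuousOn g' (Icc 0 t))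
    (hg0 : ∀ r ∈ Icc 0 t, 0 ≤ g r) (hgz : g 0 = 0) : 0 ≤ fracInt (μ + 1) g' t := by
  have hK : Continuous fun r => omega (μ + 1) (t - r) :=
    (continuous_omega_add_one hμ.le).comp (continuous_const.sub continuous_id)
  have hgc : ContinuousOn g (Icc 0 t) := fun r hr => (hg r hr).continuousAt.continuousWithinAt
  have key := intervalIntegral.sub_le_integral_of_hasDeriv_right_of_le
    (g := fun r => omega (μ + 1) (t - r) * g r)
    (g' := fun r => -omega μ (t - r) * g r + omega (μ + 1) (t - r) * g' r)
    (φ := fun r => omega (μ + 1) (t - r) • g' r) ht (hK.continuousOn.mul hgc)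
    (fun r hr => by
      have h1 := (hasDerivAt_omega_add_one hμ (sub_pos.2 hr.2)).comp r
        ((hasDerivAt_id r).const_sub t)
      have h2 := h1.fun_mul (hg r (Ioo_subset_Icc_self hr))
      exact HasDerivAt.hasDerivWithinAt (by simpa [Function.comp_def] using h2))
    (hK.continuousOn.smul hg').integrableOn_Icc
    (fun r hr => by
      have h1 := mul_nonneg (omega_nonneg hμ (sub_pos.2 hr.2).le) (hg0 r (Ioo_subset_Icc_self hr))
      simp only [smul_eq_mul]
      linarith)
  simpa [fracInt, hgz, omega_add_one_zero hμ.ne'] using key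

/-- Alikhanov's inequality. -/
lemma fracInt_inner_le_inner_fracInt {H : Type*} [NormedAddCommGroup H] [InnerProductSpace ℝ H]
    [CompleteSpace H] {μ s : ℝ} (hμ : 0 < μ) (hμ1 : μ ≤ 1) (hs : 0 ≤ s) {w w' : ℝ → H}
    (hw : ∀ r ∈ Icc 0 s, HasDerivAt w (w' r) r) (hw' : ContinuousOn w' (Icc 0 s)) :
    fracInt μ (fun r => ⟪w r, w' r⟫) s ≤ ⟪fracInt μ w' s, w s⟫ := by
  have hwc : ContinuousOn w (Icc 0 s) := fun r hr => (hw r hr).continuousAt.continuousWithinAt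
  have hk := intervalIntegrable_omega_sub hμ s 0 s
  have h1 : ⟪fracInt μ w' s, w s⟫ = fracInt μ (fun r => ⟪w s, w' r⟫) s := by
    have h := (innerSL ℝ (w s)).intervalIntegral_comp_comm
      (hk.smul_continuousOn (by rwa [uIcc_of_le hs] : ContinuousOn w' (uIcc 0 s)))
    rw [real_inner_comm]
    simpa [fracInt, inner_smul_right] using h.symm
  have h2 : fracInt μ (fun r => 2 * ⟪w r - w s, w' r⟫) s ≤ 0 := by
    refine fracInt_deriv_nonpos (f := fun r => ‖w r - w s‖ ^ 2) hμ hμ1 hs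
      (fun r hr => ((hw r hr).sub_const (w s)).norm_sq) ?_ (fun r _ => by positivity) (by simp)
    exact continuousOn_const.mul ((hwc.sub continuousOn_const).inner hw')
  have h3 : fracInt μ (fun r => 2 * ⟪w r - w s, w' r⟫) s =
      2 * (fracInt μ (fun r => ⟪w r, w' r⟫) s - fracInt μ (fun r => ⟪w s, w' r⟫) s) := by
    unfold fracInt
    rw [← intervalIntegral.integral_sub, ← intervalIntegral.integral_const_mul]
    · congr 1
      funext r
      simp only [inner_sub_left, smul_eq_mul]
      ring
    · refine hk.smul_continuousOn ?_
      rw [uIcc_of_le hs]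
      exact hwc.inner hw'
    · refine hk.smul_continuousOn ?_
      rw [uIcc_of_le hs]
      exact continuousOn_const.inner hw'
  linarith

theorem stmt_3 {H : Type*} [NormedAddCommGroup H] [InnerProductSpace ℝ H] [CompleteSpace H]
    {α T : ℝ} (hα0 : 0 < α) (hα1 : α < 1) (hT : 0 < T)
    {w w' : ℝ → H} (hderiv : ∀ s ∈ Set.Icc (0:ℝ) T, HasDerivAt w (w' s) s)
    (hderivcont : ContinuousOn w' (Set.Icc 0 T)) (hzero : w 0 = 0)
    {t : ℝ} (ht : t ∈ Set.Icc (0:ℝ) T) :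
    0 ≤ ∫ s in (0:ℝ)..t, ⟪fracInt (1 - α) w' s, w s⟫ := by
  have hμ : 0 < 1 - α := by linarith
  have hsub : ∀ s ∈ Icc 0 t, Icc 0 s ⊆ Icc 0 T := fun s hs =>
    Icc_subset_Icc_right (hs.2.trans ht.2)
  have hsubt := hsub t (right_mem_Icc.2 ht.1)
  by_cases hI : IntervalIntegrable (fun s => ⟪fracInt (1 - α) w' s, w s⟫) volume 0 t
  swap
  · rw [intervalIntegral.integral_undef hI]
  have hwc : ContinuousOn w (Icc 0 t) := fun r hr =>
    (hderiv r (hsubt hr)).continuousAt.continuousWithinAt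
  have hgc : ContinuousOn (fun r => ⟪w r, w' r⟫) (Icc 0 t) := hwc.inner (hderivcont.mono hsubt)
  obtain ⟨hint, heq⟩ := integral_fracInt hμ ht.1 (hgc.intervalIntegrable_of_Icc ht.1)
  refine le_trans ?_ (intervalIntegral.integral_mono_on ht.1 hint hI fun s hs =>
    fracInt_inner_le_inner_fracInt hμ (by linarith) hs.1 (fun r hr => hderiv r (hsub s hs hr))
      (hderivcont.mono (hsub s hs)))
  rw [heq]
  refine fracInt_add_one_deriv_nonneg (g := fun r => ‖w r‖ ^ 2 / 2) hμ ht.1 (fun r hr => ?_) hgc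
    (fun r _ => by positivity) (by simp [hzero])
  simpa using (hderiv r (hsubt hr)).norm_sq.div_const 2
end

section
/- Let X be a real Banach space, let 0 < α < 1 and T > 0, and let w : [0,T] → X be continuously differentiable. Define W(t) = t·w(t). Then for every t ∈ (0,T], t·(∂_t^α w)(t) = (∂_t^α W)(t) − α (I^{1-α}w)(t) − t ω_{1-α}(t) w(0). -/
open MeasureTheory Real Set

/-- Caputo fractional derivative `(∂_t^α v)(t) = ∫_0^t ω_{1-α}(t-s) v'(s) ds`, expressed in
terms of the derivative `v'` of `v`. -/
noncomputable def caputo {X : Type*} [NormedAddCommGroup X] [NormedSpace ℝ X]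
    (α : ℝ) (v' : ℝ → X) (t : ℝ) : X :=
  ∫ s in (0:ℝ)..t, omega (1 - α) (t - s) • v' s

theorem intervalIntegrable_omega_comp_sub {μ : ℝ} (hμ : 0 < μ) (t : ℝ) :
    IntervalIntegrable (fun s => omega μ (t - s)) volume 0 t := by
  have h : IntervalIntegrable (fun s : ℝ => s ^ (μ - 1)) volume t 0 :=
    intervalIntegral.intervalIntegrable_rpow' (by linarith)
  have h' := (h.comp_sub_left t).div_const (Real.Gamma μ)
  simpa [omega] using h'

theorem mul_omega {μ x : ℝ} (hμ : 0 < μ) (hx : 0 ≤ x) :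
    x * omega μ x = x ^ μ / Real.Gamma μ := by
  rcases hx.eq_or_lt with rfl | hx
  · simp [Real.zero_rpow hμ.ne']
  · rw [omega, Real.rpow_sub_one hx.ne']
    field_simp

theorem integral_mul_omega_smul_deriv_sub {X : Type*} [NormedAddCommGroup X] [NormedSpace ℝ X]
    [CompleteSpace X] {μ t : ℝ} (hμ : 0 < μ) (ht : 0 ≤ t) {w w' : ℝ → X}
    (hderiv : ∀ s ∈ Set.Icc (0:ℝ) t, HasDerivAt w (w' s) s)
    (hderivcont : ContinuousOn w' (Set.Icc 0 t)) :
    ∫ s in (0:ℝ)..t, (((t - s) * omega μ (t - s)) • w' s - (μ * omega μ (t - s)) • w s) =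
      -((t * omega μ t) • w 0) := by
  have hw : ContinuousOn w (Set.Icc 0 t) :=
    fun s hs => (hderiv s hs).continuousAt.continuousWithinAt
  have hint := intervalIntegrable_omega_comp_sub hμ t
  have hu : Set.uIcc 0 t = Set.Icc 0 t := Set.uIcc_of_le ht
  have hg : Continuous fun s : ℝ => (t - s) ^ μ / Real.Gamma μ :=
    ((continuous_const.sub continuous_id).rpow_const fun _ => Or.inr hμ.le).div_const _
  have key := intervalIntegral.integral_eq_sub_of_hasDerivAt_of_le ht
    (f := fun s => ((t - s) ^ μ / Real.Gamma μ) • w s)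
    (f' := fun s => ((t - s) * omega μ (t - s)) • w' s - (μ * omega μ (t - s)) • w s)
    (hg.continuousOn.smul hw) ?_ ?_
  · rw [key, mul_omega hμ ht]
    simp [Real.zero_rpow hμ.ne']
  · intro s hs
    have hpos : 0 < t - s := sub_pos.2 hs.2
    have hd := ((((hasDerivAt_id s).const_sub t).rpow_const (p := μ)
      (Or.inl hpos.ne')).div_const (Real.Gamma μ)).smul (hderiv s ⟨hs.1.le, hs.2.le⟩)
    refine hd.congr_deriv ?_
    rw [mul_omega hμ hpos.le]
    simp only [omega, id]
    module
  · refine IntervalIntegrable.sub ?_ ?_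
    · refine IntervalIntegrable.smul_continuousOn ?_ (by rwa [hu])
      exact hint.continuousOn_mul (by fun_prop)
    · exact (hint.const_mul μ).smul_continuousOn (by rwa [hu])

/-- `t (∂_t^α w)(t) = (∂_t^α W)(t) - α (I^{1-α} w)(t) - t ω_{1-α}(t) w(0)` where
`W(t) = t w(t)`, whose derivative is `W'(s) = w(s) + s w'(s)`. -/
theorem stmt_7 {X : Type*} [NormedAddCommGroup X] [NormedSpace ℝ X] [CompleteSpace X]
    {α T : ℝ} (hα0 : 0 < α) (hα1 : α < 1) (hT : 0 < T)
    {w w' : ℝ → X} (hderiv : ∀ s ∈ Set.Icc (0:ℝ) T, HasDerivAt w (w' s) s)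
    (hderivcont : ContinuousOn w' (Set.Icc 0 T))
    {t : ℝ} (ht : t ∈ Set.Ioc (0:ℝ) T) :
    t • caputo α w' t =
      caputo α (fun s => w s + s • w' s) t - α • fracInt (1 - α) w t
        - (t * omega (1 - α) t) • w 0 := by
  have hsub : Set.Icc 0 t ⊆ Set.Icc 0 T := Set.Icc_subset_Icc_right ht.2
  have hμ : 0 < 1 - α := sub_pos.2 hα1
  have hd : ∀ s ∈ Set.Icc (0:ℝ) t, HasDerivAt w (w' s) s := fun s hs => hderiv s (hsub hs)
  have hc : ContinuousOn w' (Set.Icc 0 t) := hderivcont.mono hsub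
  have hw : ContinuousOn w (Set.Icc 0 t) :=
    fun s hs => (hd s hs).continuousAt.continuousWithinAt
  have hu : Set.uIcc 0 t = Set.Icc 0 t := Set.uIcc_of_le ht.1.le
  have hint := intervalIntegrable_omega_comp_sub hμ t
  have key := integral_mul_omega_smul_deriv_sub hμ ht.1.le hd hc
  have i1 : IntervalIntegrable (fun s => omega (1 - α) (t - s) • w s) volume 0 t :=
    hint.smul_continuousOn (by rwa [hu])
  have i2 : IntervalIntegrable (fun s => omega (1 - α) (t - s) • w' s) volume 0 t :=
    hint.smul_continuousOn (by rwa [hu])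
  have i3 : IntervalIntegrable (fun s => omega (1 - α) (t - s) • (w s + s • w' s)) volume 0 t :=
    hint.smul_continuousOn (by rw [hu]; exact hw.add (continuousOn_id.smul hc))
  have i4 : IntervalIntegrable (fun s => α • omega (1 - α) (t - s) • w s) volume 0 t := i1.smul α
  have i5 : IntervalIntegrable (fun s => t • omega (1 - α) (t - s) • w' s) volume 0 t := i2.smul t
  rw [sub_eq_add_neg _ ((t * omega (1 - α) t) • w 0), ← key, caputo, caputo, fracInt,
    ← intervalIntegral.integral_smul, ← intervalIntegral.integral_smul,
    ← intervalIntegral.integral_sub i3 i4, ← sub_eq_iff_eq_add',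
    ← intervalIntegral.integral_sub i5 (i3.sub i4)]
  refine intervalIntegral.integral_congr fun s _ => ?_
  module
end
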